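/- arXiv:1904.04682 — 2 statements merged into one kernel-verified Lean document; each statement's English description precedes it below -/
import Mathlib

section
/- Let m ≥ 2 be an integer and let D = (V,E,w) be a vertex-weighted oriented m-partite graph of the second class (with m parts), having no isolated vertices. Assume w(x) = 1 for every source vertex of D and w(x) ≥ 2 for every non-source vertex x ∈ V \ (V_1 ⊔ V_m). Then the Castelnuovo–Mumford regularity of the edge ideal satisfies reg(I(D)) = (Σ_{x ∈ V} w(x)) − |V \ V_1| + 1. -/
open MvPolynomial

noncomputable section

namespace WOG

variable {k : Type} [Field k]

/-- The maximal graded ideal `(x : x ∈ V)` of the polynomial ring. -/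
def mIdeal (k V : Type) [Field k] : Ideal (MvPolynomial V k) :=
  Ideal.span (Set.range (X : V → MvPolynomial V k))

/-- The edge ideal `I(D) = (x * y^{w(y)} : (x,y) ∈ E)` of a vertex-weighted
oriented graph `D = (V, E, w)`. -/
def edgeIdeal (k : Type) [Field k] {V : Type} (E : Set (V × V)) (w : V → ℕ) :
    Ideal (MvPolynomial V k) :=
  Ideal.span {p : MvPolynomial V k | ∃ e ∈ E, p = X e.1 * X e.2 ^ w e.2}

/-- A minimal graded free resolution `⋯ → F₁ → F₀ → I → 0` of an ideal
`I` of the polynomial ring `S = k[x : x ∈ V]`, where `Fᵢ` is the graded free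
module with (finite) homogeneous basis `ι i` whose element `a` sits in degree
`deg i a` (i.e. `Fᵢ = ⊕_a S(- deg i a)`), the maps are graded (degree-preserving)
`S`-linear maps, the complex is exact, and all the matrix entries of the
differentials lie in the maximal graded ideal `𝔪 = (x : x ∈ V)` (minimality). -/
structure MinFreeRes {V : Type} (I : Ideal (MvPolynomial V k)) where
  ι : ℕ → Type
  finite : ∀ i, Finite (ι i)
  deg : ∀ i, ι i → ℕ
  aug : ((ι 0) →₀ MvPolynomial V k) →ₗ[MvPolynomial V k] MvPolynomial V k
  d : ∀ i, ((ι (i + 1)) →₀ MvPolynomial V k) →ₗ[MvPolynomial V k] ((ι i) →₀ MvPolynomial V k)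
  aug_range : LinearMap.range aug = I
  exact_zero : LinearMap.range (d 0) = LinearMap.ker aug
  exact_succ : ∀ i, LinearMap.range (d (i + 1)) = LinearMap.ker (d i)
  aug_homog : ∀ a, (aug (Finsupp.single a 1)).IsHomogeneous (deg 0 a)
  d_homog : ∀ i a b, (d i (Finsupp.single a 1)) b = 0 ∨
      ∃ e, deg (i + 1) a = deg i b + e ∧ ((d i (Finsupp.single a 1)) b).IsHomogeneous e
  minimal : ∀ i a b, (d i (Finsupp.single a 1)) b ∈ mIdeal k V

/-- The graded Betti number `β_{i,j}(I)`, read off from a minimal graded free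
resolution: the number of basis elements of `Fᵢ` of degree `j`. -/
def MinFreeRes.betti {V : Type} {I : Ideal (MvPolynomial V k)} (R : MinFreeRes I)
    (i j : ℕ) : ℕ :=
  Nat.card {a : R.ι i // R.deg i a = j}

/-- The set `{j - i : β_{i,j}(I) ≠ 0}`; its greatest element is the
Castelnuovo–Mumford regularity `reg I`. -/
def MinFreeRes.regSet {V : Type} {I : Ideal (MvPolynomial V k)} (R : MinFreeRes I) :
    Set ℤ :=
  {t : ℤ | ∃ i j : ℕ, R.betti i j ≠ 0 ∧ t = (j : ℤ) - (i : ℤ)}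

/-- The set `{i : β_{i,j}(I) ≠ 0 for some j}`; its greatest element is the
projective dimension `pd I`. -/
def MinFreeRes.pdSet {V : Type} {I : Ideal (MvPolynomial V k)} (R : MinFreeRes I) :
    Set ℕ :=
  {i : ℕ | ∃ j : ℕ, R.betti i j ≠ 0}

/-- The set of lengths of `I`-regular sequences contained in the maximal graded
ideal `𝔪 = (x : x ∈ V)`; its greatest element is `depth I`. -/
def depthSet (k : Type) [Field k] {V : Type} (I : Ideal (MvPolynomial V k)) : Set ℕ :=
  {n : ℕ | ∃ rs : List (MvPolynomial V k), rs.length = n ∧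
    (∀ r ∈ rs, r ∈ mIdeal k V) ∧ RingTheory.Sequence.IsRegular (↥I) rs}

end WOG

namespace WOG

section Koszul

variable {V : Type} [Fintype V] [LinearOrder V]

/-- The sign `(-1) ^ #{u ∈ F | u < v}` with which `e_v` is moved into the wedge of the `e_u`. -/
def koszulSign (v : V) (F : Finset V) : ℤ := (-1) ^ (F.filter (· < v)).card

omit [Fintype V] in
lemma koszulSign_mul_self (v : V) (F : Finset V) : koszulSign v F * koszulSign v F = 1 := by
  rw [koszulSign, ← mul_pow]; simp

omit [Fintype V] in
lemma koszulSign_insert {u v : V} {F : Finset V} (hv : v ∉ F) :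
    koszulSign u (insert v F) = koszulSign u F * (if v < u then -1 else 1) := by
  unfold koszulSign
  rw [Finset.filter_insert]
  split_ifs with h
  · rw [Finset.card_insert_of_notMem (by simp [hv]), pow_succ]
  · simp

omit [Fintype V] in
lemma koszulSign_anticomm {u v : V} {F : Finset V} (huv : u ≠ v) (hu : u ∉ F) (hv : v ∉ F) :
    koszulSign v F * koszulSign u (insert v F) = -(koszulSign u F * koszulSign v (insert u F)) := by
  rw [koszulSign_insert hv, koszulSign_insert hu]
  rcases lt_or_gt_of_ne huv with h | h
  · rw [if_neg h.not_gt, if_pos h]; ring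
  · rw [if_neg h.not_gt, if_pos h]; ring

omit [Fintype V] in
lemma koszulSign_insert_mul_insert {u v : V} {F : Finset V} (huv : u ≠ v) (hu : u ∉ F)
    (hv : v ∉ F) :
    koszulSign u (insert v F) * koszulSign v (insert u F) = -(koszulSign v F * koszulSign u F) := by
  rw [koszulSign_insert hv, koszulSign_insert hu]
  rcases lt_or_gt_of_ne huv with h | h
  · rw [if_neg h.not_gt, if_pos h]; ring
  · rw [if_neg h.not_gt, if_pos h]; ring

/-- The differential of the Koszul complex of all variables with coefficients in `M`; the value
`z F` is the coefficient of the basis element indexed by `F`. -/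
def koszul (k : Type) [Field k] {M : Type*} [AddCommGroup M] [Module (MvPolynomial V k) M] :
    (Finset V → M) →ₗ[MvPolynomial V k] (Finset V → M) where
  toFun z F := ∑ v ∈ Fᶜ, ((koszulSign v F : MvPolynomial V k) * X v) • z (insert v F)
  map_add' y z := by ext F; simp [Finset.sum_add_distrib]
  map_smul' c z := by
    ext F
    simp only [Pi.smul_apply, Finset.smul_sum, RingHom.id_apply]
    exact Finset.sum_congr rfl fun v _ ↦ smul_comm _ _ _

variable {k : Type} [Field k]

section Module

variable {M N : Type*} [AddCommGroup M] [Module (MvPolynomial V k) M]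
  [AddCommGroup N] [Module (MvPolynomial V k) N]

lemma koszul_apply (z : Finset V → M) (F : Finset V) :
    koszul k z F = ∑ v ∈ Fᶜ, ((koszulSign v F : MvPolynomial V k) * X v) • z (insert v F) :=
  rfl

lemma koszul_koszul (z : Finset V → M) : koszul k (koszul k z) = 0 := by
  ext F
  simp only [koszul_apply, Finset.smul_sum, smul_smul, Pi.zero_apply]
  rw [Finset.sum_sigma']
  refine Finset.sum_involution (fun p _ ↦ ⟨p.2, p.1⟩) ?_ ?_ ?_ ?_
  · rintro ⟨v, u⟩ h
    simp only [Finset.mem_sigma, Finset.mem_compl, Finset.mem_insert, not_or] at h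
    obtain ⟨hv, huv, hu⟩ := h
    rw [Finset.insert_comm u v, ← add_smul]
    have := congrArg (Int.cast : ℤ → MvPolynomial V k) (koszulSign_anticomm huv hu hv)
    push_cast at this
    convert! zero_smul (MvPolynomial V k) _
    linear_combination (X v * X u : MvPolynomial V k) * this
  · rintro ⟨v, u⟩ h _ h'
    simp only [Finset.mem_sigma, Finset.mem_compl, Finset.mem_insert, not_or] at h
    simp only [Sigma.mk.injEq] at h'
    exact h.2.1 h'.1
  · rintro ⟨v, u⟩ h
    simp only [Finset.mem_sigma, Finset.mem_compl, Finset.mem_insert, not_or] at h ⊢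
    exact ⟨h.2.2, fun e ↦ h.2.1 e.symm, h.1⟩
  · rintro ⟨v, u⟩ h
    rfl

lemma koszul_comp (f : M →ₗ[MvPolynomial V k] N) (z : Finset V → M) :
    koszul k (fun F ↦ f (z F)) = fun F ↦ f (koszul k z F) := by
  ext F
  simp [koszul_apply, map_sum]

end Module

/-- Koszul chains with polynomial coefficients, of homological degree `q` and total degree `j`. -/
def IsChain (q : ℕ) (j : ℤ) (z : Finset V → MvPolynomial V k) : Prop :=
  ∀ F m, coeff m (z F) ≠ 0 → F.card = q ∧ (m.degree : ℤ) + q = j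

omit [Fintype V] [LinearOrder V] in
lemma IsChain.sub {q : ℕ} {j : ℤ} {y z : Finset V → MvPolynomial V k}
    (hy : IsChain q j y) (hz : IsChain q j z) : IsChain q j (y - z) := by
  intro F m h
  by_cases h' : coeff m (y F) = 0
  · exact hz F m fun h₂ ↦ h (by simp [h', h₂])
  · exact hy F m h'

omit [Fintype V] [LinearOrder V] in
lemma IsChain.add {q : ℕ} {j : ℤ} {y z : Finset V → MvPolynomial V k}
    (hy : IsChain q j y) (hz : IsChain q j z) : IsChain q j (y + z) := by
  intro F m h
  by_cases h' : coeff m (y F) = 0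
  · exact hz F m fun h₂ ↦ h (by simp [h', h₂])
  · exact hy F m h'

omit [Fintype V] [LinearOrder V] in
lemma exists_coeff_ne_zero_of_sum {α : Type*} {s : Finset α} {f : α → MvPolynomial V k}
    {m : V →₀ ℕ} (h : coeff m (∑ a ∈ s, f a) ≠ 0) : ∃ a ∈ s, coeff m (f a) ≠ 0 := by
  rw [coeff_sum] at h
  exact Finset.exists_ne_zero_of_sum_ne_zero h

omit [Fintype V] [LinearOrder V] in
lemma coeff_intCast_mul (n : ℤ) (m : V →₀ ℕ) (p : MvPolynomial V k) :
    coeff m ((n : MvPolynomial V k) * p) = n * coeff m p := by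
  rw [← map_intCast (C : k →+* MvPolynomial V k), coeff_C_mul]

/-- A monomial of the Koszul differential comes from a monomial of the chain. -/
lemma exists_of_coeff_koszul_ne_zero {z : Finset V → MvPolynomial V k} {F : Finset V}
    {m : V →₀ ℕ} (h : coeff m (koszul k z F) ≠ 0) :
    ∃ v ∉ F, ∃ n, m = Finsupp.single v 1 + n ∧ coeff n (z (insert v F)) ≠ 0 := by
  rw [koszul_apply] at h
  obtain ⟨v, hv, h⟩ := exists_coeff_ne_zero_of_sum h
  rw [smul_eq_mul, mul_assoc, coeff_intCast_mul] at h
  have h := right_ne_zero_of_mul h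
  rw [X, coeff_monomial_mul'] at h
  split_ifs at h with hle
  · refine ⟨v, by simpa using hv, m - Finsupp.single v 1, ?_, by simpa using h⟩
    rw [add_tsub_cancel_of_le hle]
  · exact absurd rfl h

lemma IsChain.koszul {q : ℕ} {j : ℤ} {z : Finset V → MvPolynomial V k}
    (hz : IsChain (q + 1) j z) : IsChain q j (koszul k z) := by
  intro F m h
  obtain ⟨v, hv, n, rfl, hn⟩ := exists_of_coeff_koszul_ne_zero h
  obtain ⟨h1, h2⟩ := hz _ _ hn
  rw [Finset.card_insert_of_notMem hv] at h1
  refine ⟨by omega, ?_⟩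
  simp only [map_add, Finsupp.degree_single]
  push_cast at h2 ⊢
  omega

lemma IsChain.koszul_zero {j : ℤ} {z : Finset V → MvPolynomial V k}
    (hz : IsChain 0 j z) : WOG.koszul k z = 0 := by
  ext F m
  by_contra h
  obtain ⟨v, hv, n, rfl, hn⟩ := exists_of_coeff_koszul_ne_zero (by simpa using h)
  obtain ⟨h1, -⟩ := hz _ _ hn
  simp at h1

/-- Division by a monomial as an additive map. -/
def divHom (s : V →₀ ℕ) : MvPolynomial V k →+ MvPolynomial V k where
  toFun p := p.divMonomial s
  map_zero' := zero_divMonomial s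
  map_add' p q := add_divMonomial p q s

omit [Fintype V] [LinearOrder V] in
lemma coeff_divHom (s m : V →₀ ℕ) (p : MvPolynomial V k) :
    coeff m (divHom s p) = coeff (s + m) p :=
  coeff_divMonomial s p m

omit [Fintype V] in
lemma divHom_single_X_mul {u v : V} (huv : u ≠ v) (p : MvPolynomial V k) :
    divHom (Finsupp.single v 1) (X u * p) = X u * divHom (Finsupp.single v 1) p := by
  ext m
  simp only [coeff_divHom, coeff_X_mul', Finsupp.mem_support_iff, Finsupp.add_apply,
    Finsupp.single_eq_of_ne huv, zero_add]
  split_ifs with h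
  · congr 1
    rw [add_tsub_assoc_of_le]
    simpa [Nat.one_le_iff_ne_zero] using h
  · rfl

omit [Fintype V] [LinearOrder V] in
lemma divHom_single_X_mul_self (v : V) (p : MvPolynomial V k) :
    divHom (Finsupp.single v 1) (X v * p) = p := by
  ext m
  rw [coeff_divHom, coeff_X_mul]

/-- The contraction of the Koszul complex in the direction of one variable. -/
def contract (v : V) (z : Finset V → MvPolynomial V k) (F : Finset V) : MvPolynomial V k :=
  if v ∈ F then (koszulSign v (F.erase v) : MvPolynomial V k) *
    divHom (Finsupp.single v 1) (z (F.erase v)) else 0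

omit [Fintype V] in
lemma IsChain.contract {q : ℕ} {j : ℤ} {z : Finset V → MvPolynomial V k}
    (hz : IsChain q j z) (v : V) : IsChain (q + 1) j (contract v z) := by
  intro F m h
  unfold WOG.contract at h
  split_ifs at h with hv
  · rw [coeff_intCast_mul, coeff_divHom] at h
    obtain ⟨h1, h2⟩ := hz _ _ (right_ne_zero_of_mul h)
    rw [Finset.card_erase_of_mem hv] at h1
    have := Finset.card_pos.2 ⟨v, hv⟩
    simp only [map_add, Finsupp.degree_single] at h2
    push_cast at h2 ⊢
    refine ⟨by omega, by omega⟩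
  · simp at h

/-- On cycles the contraction is a homotopy from the identity to setting `x_v = 0`. -/
lemma koszul_contract_of_notMem {z : Finset V → MvPolynomial V k}
    {v : V} {F : Finset V} (hv : v ∉ F) :
    koszul k (contract v z) F = X v * divHom (Finsupp.single v 1) (z F) := by
  rw [koszul_apply, Finset.sum_eq_single v]
  · simp only [contract, Finset.mem_insert_self, if_true, Finset.erase_insert hv, smul_eq_mul]
    have := congrArg (Int.cast : ℤ → MvPolynomial V k) (koszulSign_mul_self v F)
    push_cast at this
    linear_combination X v * divHom (Finsupp.single v 1) (z F) * this
  · intro u _ huv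
    simp [contract, hv, huv.symm]
  · simp [hv]

lemma koszul_contract_of_mem {z : Finset V → MvPolynomial V k} (hz : koszul k z = 0)
    {v : V} {F : Finset V} (hv : v ∈ F) : koszul k (contract v z) F = z F := by
  obtain ⟨F, hvF, rfl⟩ : ∃ F', v ∉ F' ∧ insert v F' = F :=
    ⟨F.erase v, by simp, Finset.insert_erase hv⟩
  have h0 := congrFun hz F
  rw [koszul_apply, ← Finset.insert_erase (Finset.mem_compl.2 hvF),
    Finset.sum_insert (by simp), Pi.zero_apply] at h0
  have h1 := congrArg (divHom (Finsupp.single v 1)) h0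
  rw [map_zero, map_add, map_sum] at h1
  have key (u : V) (p : MvPolynomial V k) :
      divHom (Finsupp.single v 1) (((koszulSign u F : MvPolynomial V k) * X u) • p) =
        (koszulSign u F : MvPolynomial V k) * divHom (Finsupp.single v 1) (X u * p) := by
    rw [smul_eq_mul, mul_assoc, ← zsmul_eq_mul, map_zsmul, zsmul_eq_mul]
  rw [key, divHom_single_X_mul_self] at h1
  have hs := congrArg (Int.cast : ℤ → MvPolynomial V k) (koszulSign_mul_self v F)
  push_cast at hs
  have h2 : z (insert v F) = - ∑ u ∈ Fᶜ.erase v, (koszulSign v F : MvPolynomial V k) *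
      divHom (Finsupp.single v 1) (((koszulSign u F : MvPolynomial V k) * X u) •
        z (insert u F)) := by
    rw [← Finset.mul_sum]
    linear_combination (koszulSign v F : MvPolynomial V k) * h1 - z (insert v F) * hs
  rw [h2, koszul_apply, ← Finset.sum_neg_distrib]
  refine Finset.sum_congr (by ext; simp) fun u hu ↦ ?_
  have huv : u ≠ v := by rintro rfl; simp at hu
  have huF : u ∉ F := fun h ↦ by simp [h] at hu
  have hvu : v ∉ insert u F := by simp [huv.symm, hvF]
  rw [key, divHom_single_X_mul huv, contract, if_pos (by simp), Finset.insert_comm,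
    Finset.erase_insert hvu]
  have := congrArg (Int.cast : ℤ → MvPolynomial V k) (koszulSign_insert_mul_insert huv huF hvF)
  push_cast at this
  rw [smul_eq_mul]
  linear_combination X u * divHom (Finsupp.single v 1) (z (insert u F)) * this

/-- The Koszul complex of the polynomial ring is acyclic away from the constants. -/
theorem exists_koszul_eq {q : ℕ} {j : ℤ} {z : Finset V → MvPolynomial V k}
    (hz : IsChain q j z) (h0 : koszul k z = 0) (hc : coeff 0 (z ∅) = 0) :
    ∃ u, IsChain (q + 1) j u ∧ koszul k u = z := by
  suffices H : ∀ A : Finset V, ∃ u : Finset V → MvPolynomial V k, IsChain (q + 1) j u ∧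
      ∀ v ∈ A, ∀ F m, coeff m ((z - koszul k u) F) ≠ 0 → v ∉ F ∧ m v = 0 by
    obtain ⟨u, hu, h⟩ := H Finset.univ
    refine ⟨u, hu, ?_⟩
    ext F m
    by_contra hne
    have hne' : coeff m ((z - koszul k u) F) ≠ 0 := by
      simpa [sub_eq_zero] using fun h ↦ hne h.symm
    obtain rfl : F = ∅ := Finset.eq_empty_of_forall_notMem fun v ↦
      (h v (Finset.mem_univ v) F m hne').1
    obtain rfl : m = 0 := Finsupp.ext fun v ↦ (h v (Finset.mem_univ v) _ m hne').2
    have hk : coeff 0 (koszul k u ∅) = 0 := by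
      by_contra h
      obtain ⟨v, -, n, hn, -⟩ := exists_of_coeff_koszul_ne_zero h
      have := DFunLike.congr_fun hn v
      simp at this
      omega
    exact hne (by rw [hk, hc])
  intro A
  induction A using Finset.induction_on with
  | empty => exact ⟨0, fun F m h ↦ by simp at h, by simp⟩
  | insert v A hv ih =>
    obtain ⟨u, hu, h⟩ := ih
    set y := z - koszul k u with hy
    have hyc : IsChain q j y := hz.sub hu.koszul
    have hy0 : koszul k y = 0 := by rw [hy, map_sub, h0, koszul_koszul, sub_zero]
    refine ⟨u + contract v y, hu.add (hyc.contract v), ?_⟩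
    rw [map_add, ← sub_sub, ← hy]
    have step {F : Finset V} {m : V →₀ ℕ}
        (hm : coeff m ((y - koszul k (contract v y)) F) ≠ 0) :
        (v ∉ F ∧ m v = 0) ∧ coeff m (y F) ≠ 0 := by
      by_cases hvF : v ∈ F
      · simp [koszul_contract_of_mem hy0 hvF] at hm
      rw [Pi.sub_apply, koszul_contract_of_notMem hvF, coeff_sub, X, coeff_monomial_mul',
        coeff_divHom] at hm
      split_ifs at hm with hle
      · simp [add_tsub_cancel_of_le hle] at hm
      · refine ⟨⟨hvF, ?_⟩, by simpa using hm⟩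
        simpa using hle
    intro x hx F m hm
    obtain ⟨h1, h2⟩ := step hm
    rcases Finset.mem_insert.1 hx with rfl | hx
    · exact h1
    · exact h x hx F m h2

end Koszul

end WOG

namespace WOG

section FreeModule

variable {V : Type} {k : Type} [Field k]

/-- The part of a polynomial in an integral degree. -/
def degPart (t : ℤ) (p : MvPolynomial V k) : MvPolynomial V k :=
  if 0 ≤ t then homogeneousComponent t.toNat p else 0

lemma coeff_degPart (t : ℤ) (p : MvPolynomial V k) (m : V →₀ ℕ) :
    coeff m (degPart t p) = if (m.degree : ℤ) = t then coeff m p else 0 := by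
  unfold degPart
  split_ifs with h1 h2 h2
  · rw [coeff_homogeneousComponent, if_pos (by omega)]
  · rw [coeff_homogeneousComponent, if_neg (by omega)]
  · omega
  · simp

lemma degPart_mul {e t : ℤ} {p : MvPolynomial V k} (hp : ∀ m, coeff m p ≠ 0 → (m.degree : ℤ) = e)
    (y : MvPolynomial V k) : degPart (t + e) (y * p) = degPart t y * p := by
  classical
  ext m
  rw [coeff_degPart, coeff_mul, coeff_mul]
  have hd {x : (V →₀ ℕ) × (V →₀ ℕ)} (hx : x ∈ Finset.HasAntidiagonal.antidiagonal m) :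
      (m.degree : ℤ) = x.1.degree + x.2.degree := by
    rw [← Finset.HasAntidiagonal.mem_antidiagonal.1 hx, map_add, Nat.cast_add]
  split_ifs with h
  · refine Finset.sum_congr rfl fun x hx ↦ ?_
    by_cases h0 : coeff x.2 p = 0
    · simp [h0]
    · rw [coeff_degPart, if_pos (by linarith [hp _ h0, hd hx])]
  · refine (Finset.sum_eq_zero fun x hx ↦ ?_).symm
    by_cases h0 : coeff x.2 p = 0
    · simp [h0]
    · rw [coeff_degPart, if_neg (fun h' ↦ h (by linarith [hp _ h0, hd hx])), zero_mul]

variable {ι κ μ : Type}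

/-- A linear map between graded free modules preserves degrees. -/
def IsGraded (degN : κ → ℕ) (degM : ι → ℕ)
    (f : (κ →₀ MvPolynomial V k) →ₗ[MvPolynomial V k] (ι →₀ MvPolynomial V k)) : Prop :=
  ∀ a b m, coeff m (f (Finsupp.single a 1) b) ≠ 0 → degN a = degM b + m.degree

lemma apply_eq_sum [Fintype κ]
    (f : (κ →₀ MvPolynomial V k) →ₗ[MvPolynomial V k] (ι →₀ MvPolynomial V k))
    (x : κ →₀ MvPolynomial V k) (b : ι) :
    f x b = ∑ a, x a * f (Finsupp.single a 1) b := by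
  classical
  conv_lhs => rw [← Finsupp.univ_sum_single x, map_sum, Finsupp.finsetSum_apply]
  refine Finset.sum_congr rfl fun a _ ↦ ?_
  rw [← smul_eq_mul, ← Finsupp.smul_apply, ← map_smul, Finsupp.smul_single, smul_eq_mul, mul_one]

lemma coeff_zero_of_mem_mIdeal {p : MvPolynomial V k} (hp : p ∈ mIdeal k V) : coeff 0 p = 0 := by
  have : mIdeal k V ≤ RingHom.ker (constantCoeff : MvPolynomial V k →+* k) := by
    rw [mIdeal, Ideal.span_le]
    rintro _ ⟨v, rfl⟩
    simp [RingHom.mem_ker]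
  exact this hp

lemma coeff_zero_apply [Finite κ]
    {f : (κ →₀ MvPolynomial V k) →ₗ[MvPolynomial V k] (ι →₀ MvPolynomial V k)}
    (hf : ∀ a b, f (Finsupp.single a 1) b ∈ mIdeal k V) (x : κ →₀ MvPolynomial V k) (b : ι) :
    coeff 0 (f x b) = 0 := by
  have := Fintype.ofFinite κ
  rw [apply_eq_sum]
  exact coeff_zero_of_mem_mIdeal (Ideal.sum_mem _ fun a _ ↦ Ideal.mul_mem_left _ _ (hf a b))

/-- Koszul chains with coefficients in a graded free module. -/
def IsFreeChain (deg : ι → ℕ) (q : ℕ) (j : ℤ) (z : Finset V → (ι →₀ MvPolynomial V k)) : Prop :=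
  ∀ a, IsChain q (j - deg a) fun F ↦ z F a

lemma IsFreeChain.sub {deg : ι → ℕ} {q : ℕ} {j : ℤ} {y z : Finset V → (ι →₀ MvPolynomial V k)}
    (hy : IsFreeChain deg q j y) (hz : IsFreeChain deg q j z) : IsFreeChain deg q j (y - z) :=
  fun a ↦ (hy a).sub (hz a)

lemma IsFreeChain.add {deg : ι → ℕ} {q : ℕ} {j : ℤ} {y z : Finset V → (ι →₀ MvPolynomial V k)}
    (hy : IsFreeChain deg q j y) (hz : IsFreeChain deg q j z) : IsFreeChain deg q j (y + z) :=
  fun a ↦ (hy a).add (hz a)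

lemma IsFreeChain.map [Finite κ] {degN : κ → ℕ} {degM : ι → ℕ}
    {f : (κ →₀ MvPolynomial V k) →ₗ[MvPolynomial V k] (ι →₀ MvPolynomial V k)}
    (hf : IsGraded degN degM f) {q : ℕ} {j : ℤ} {z : Finset V → (κ →₀ MvPolynomial V k)}
    (hz : IsFreeChain degN q j z) : IsFreeChain degM q j fun F ↦ f (z F) := by
  classical
  intro b F m h
  have := Fintype.ofFinite κ
  beta_reduce at h
  rw [apply_eq_sum] at h
  obtain ⟨a, -, h⟩ := exists_coeff_ne_zero_of_sum h
  rw [coeff_mul] at h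
  obtain ⟨x, hx, h⟩ := Finset.exists_ne_zero_of_sum_ne_zero h
  obtain ⟨h1, h2⟩ := hz a F x.1 (left_ne_zero_of_mul h)
  have h3 := hf a b x.2 (right_ne_zero_of_mul h)
  refine ⟨h1, ?_⟩
  rw [← Finset.HasAntidiagonal.mem_antidiagonal.1 hx, map_add]
  push_cast
  omega

/-- Chains with values in the range of a graded map lift to chains. -/
lemma IsFreeChain.exists_lift [Finite κ] {degN : κ → ℕ} {degM : ι → ℕ}
    {f : (κ →₀ MvPolynomial V k) →ₗ[MvPolynomial V k] (ι →₀ MvPolynomial V k)}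
    (hf : IsGraded degN degM f) {q : ℕ} {j : ℤ} {z : Finset V → (ι →₀ MvPolynomial V k)}
    (hz : IsFreeChain degM q j z) (hr : ∀ F, z F ∈ LinearMap.range f) :
    ∃ y, IsFreeChain degN q j y ∧ (fun F ↦ f (y F)) = z := by
  have := Fintype.ofFinite κ
  choose y hy using hr
  refine ⟨fun F ↦ if F.card = q then Finsupp.equivFunOnFinite.symm
    fun a ↦ degPart (j - q - degN a) (y F a) else 0, ?_, ?_⟩
  · intro a F m h
    beta_reduce at h
    split_ifs at h with hq
    · rw [Finsupp.equivFunOnFinite_symm_apply_apply, coeff_degPart] at h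
      split_ifs at h with hm
      · exact ⟨hq, by omega⟩
      · exact absurd rfl h
    · simp at h
  · ext1 F
    beta_reduce
    split_ifs with hq
    · ext1 b
      have hzb : z F b = degPart (j - q - degM b) (z F b) := by
        ext m
        rw [coeff_degPart]
        split_ifs with hm
        · rfl
        · by_contra h
          have := (hz b F m h).2
          omega
      rw [hzb, ← hy F, apply_eq_sum, apply_eq_sum]
      have hsum (s : ℤ) (g : κ → MvPolynomial V k) :
          degPart s (∑ a, g a) = ∑ a, degPart s (g a) := by
        ext m
        simp only [coeff_degPart, coeff_sum]
        split_ifs <;> simp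
      rw [hsum]
      refine Finset.sum_congr rfl fun a _ ↦ ?_
      rw [Finsupp.equivFunOnFinite_symm_apply_apply, ← degPart_mul (e := degN a - degM b)]
      · congr 1; ring
      · intro m hm
        have := hf a b m hm
        omega
    · rw [map_zero]
      ext b m
      by_contra h
      exact hq (hz b F m fun h' ↦ h (by simpa using h'.symm)).1

section

variable [Fintype V] [LinearOrder V]

lemma koszul_finsupp_apply (z : Finset V → (ι →₀ MvPolynomial V k)) (a : ι) (F : Finset V) :
    koszul k z F a = koszul k (fun F ↦ z F a) F :=
  (congrFun (koszul_comp (Finsupp.lapply (R := MvPolynomial V k) a) z) F).symm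

lemma IsFreeChain.koszul {deg : ι → ℕ} {q : ℕ} {j : ℤ} {z : Finset V → (ι →₀ MvPolynomial V k)}
    (hz : IsFreeChain deg (q + 1) j z) : IsFreeChain deg q j (koszul k z) := by
  intro a
  convert! (hz a).koszul using 1
  ext1 F
  exact koszul_finsupp_apply z a F

lemma IsFreeChain.koszul_zero {deg : ι → ℕ} {j : ℤ} {z : Finset V → (ι →₀ MvPolynomial V k)}
    (hz : IsFreeChain deg 0 j z) : WOG.koszul k z = 0 := by
  ext1 F
  ext1 a
  rw [koszul_finsupp_apply, (hz a).koszul_zero]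
  rfl

lemma IsFreeChain.exists_koszul_eq [Finite ι] {deg : ι → ℕ} {q : ℕ} {j : ℤ}
    {z : Finset V → (ι →₀ MvPolynomial V k)} (hz : IsFreeChain deg q j z)
    (h0 : WOG.koszul k z = 0) (hc : ∀ a, coeff 0 (z ∅ a) = 0) :
    ∃ u, IsFreeChain deg (q + 1) j u ∧ WOG.koszul k u = z := by
  have (a : ι) : ∃ u, IsChain (q + 1) (j - deg a) u ∧ WOG.koszul k u = fun F ↦ z F a := by
    refine WOG.exists_koszul_eq (hz a) ?_ (hc a)
    ext1 F
    rw [← koszul_finsupp_apply, h0]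
    rfl
  choose u hu h using this
  refine ⟨fun F ↦ Finsupp.equivFunOnFinite.symm fun a ↦ u a F, fun a ↦ hu a, ?_⟩
  ext1 F
  ext1 a
  rw [koszul_finsupp_apply]
  exact congrFun (h a) F

/-- Every Koszul `q`-cycle of degree `j` of the cokernel of `f` is a boundary. -/
def CokerAcyclic (degN : κ → ℕ) (degM : ι → ℕ)
    (f : (κ →₀ MvPolynomial V k) →ₗ[MvPolynomial V k] (ι →₀ MvPolynomial V k))
    (q : ℕ) (j : ℤ) : Prop :=
  ∀ z, IsFreeChain degM q j z → (∀ F, koszul k z F ∈ LinearMap.range f) →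
    ∃ u y, IsFreeChain degM (q + 1) j u ∧ IsFreeChain degN q j y ∧
      z = koszul k u + fun F ↦ f (y F)

/-- Dimension shifting along `L → N → M`. -/
theorem cokerAcyclic_succ_iff [Finite ι] [Finite κ] [Finite μ] {degL : μ → ℕ} {degN : κ → ℕ}
    {degM : ι → ℕ}
    {f : (κ →₀ MvPolynomial V k) →ₗ[MvPolynomial V k] (ι →₀ MvPolynomial V k)}
    {g : (μ →₀ MvPolynomial V k) →ₗ[MvPolynomial V k] (κ →₀ MvPolynomial V k)}
    (hf : IsGraded degN degM f) (hg : IsGraded degL degN g)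
    (hfg : LinearMap.range g = LinearMap.ker f)
    (hmin : ∀ a b, f (Finsupp.single a 1) b ∈ mIdeal k V) (q : ℕ) (j : ℤ) :
    CokerAcyclic degN degM f (q + 1) j ↔ CokerAcyclic degL degN g q j := by
  constructor
  · intro H z hz hzr
    obtain ⟨u, hu, hfu⟩ := (hz.map hf).exists_koszul_eq
      (by
        rw [koszul_comp]
        ext1 F
        have := hzr F
        rwa [hfg] at this)
      (fun a ↦ coeff_zero_apply hmin _ a)
    obtain ⟨w, y, hw, hy, rfl⟩ := H u hu fun F ↦ ⟨z F, (congrFun hfu F).symm⟩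
    rw [map_add, koszul_koszul, zero_add, koszul_comp] at hfu
    obtain ⟨x, hx, hgx⟩ := (hz.sub hy.koszul).exists_lift hg (by
      intro F
      rw [hfg, LinearMap.mem_ker, Pi.sub_apply, map_sub, sub_eq_zero]
      exact (congrFun hfu F).symm)
    exact ⟨y, x, hy, hx, by rw [hgx]; abel⟩
  · intro H z hz hzr
    obtain ⟨y, hy, hfy⟩ := hz.koszul.exists_lift hf hzr
    obtain ⟨u, x, hu, hx, rfl⟩ := H y hy (by
      intro F
      rw [hfg, LinearMap.mem_ker, ← congrFun (koszul_comp f y) F, hfy, koszul_koszul]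
      rfl)
    have hfgx (F : Finset V) : f (g (x F)) = 0 := by
      rw [← LinearMap.mem_ker, ← hfg]
      exact LinearMap.mem_range_self _ _
    have hfy' : koszul k (fun F ↦ f (u F)) = koszul k z := by
      rw [koszul_comp, ← hfy]
      ext1 F
      simp [hfgx]
    have hc := hz.sub (hu.map hf)
    obtain ⟨v, hv, hvz⟩ := hc.exists_koszul_eq (by rw [map_sub, hfy', sub_self]) (by
      intro a
      by_contra h
      simpa using (hc a ∅ 0 h).1)
    exact ⟨v, u, hv, hu, by rw [hvz]; abel⟩

namespace MinFreeRes

variable {I : Ideal (MvPolynomial V k)} (R : MinFreeRes I)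

omit [Fintype V] [LinearOrder V] in
lemma isGraded_d (i : ℕ) : IsGraded (R.deg (i + 1)) (R.deg i) (R.d i) := by
  intro a b m h
  rcases R.d_homog i a b with h0 | ⟨e, he, hh⟩
  · simp [h0] at h
  · rw [he, Finsupp.degree_eq_weight_one]
    exact congrArg _ (hh h).symm

lemma cokerAcyclic_d_iff (p q : ℕ) (j : ℤ) :
    CokerAcyclic (R.deg (p + 1)) (R.deg p) (R.d p) q j ↔
      CokerAcyclic (R.deg 1) (R.deg 0) (R.d 0) (p + q) j := by
  have := R.finite
  induction p generalizing q with
  | zero => rw [Nat.zero_add q]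
  | succ p ih =>
    rw [Nat.add_right_comm p 1 q]
    exact (cokerAcyclic_succ_iff (R.isGraded_d p) (R.isGraded_d (p + 1)) (R.exact_succ p)
      (R.minimal p) q j).symm.trans (ih (q + 1))

omit [LinearOrder V] [Fintype V] in
lemma betti_eq_zero_iff (i j : ℕ) : R.betti i j = 0 ↔ ∀ a, R.deg i a ≠ j := by
  have := R.finite i
  rw [betti, Nat.card_eq_zero, or_iff_left (not_infinite_iff_finite.2 inferInstance),
    isEmpty_subtype]

lemma betti_eq_zero_iff_cokerAcyclic (i j : ℕ) :
    R.betti i j = 0 ↔ CokerAcyclic (R.deg (i + 1)) (R.deg i) (R.d i) 0 j := by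
  classical
  have := R.finite
  rw [betti_eq_zero_iff]
  constructor
  · intro h z hz _
    obtain ⟨u, hu, huz⟩ := hz.exists_koszul_eq hz.koszul_zero (by
      intro a
      by_contra hc
      have := (hz a ∅ 0 hc).2
      simp at this
      exact h a (by omega))
    refine ⟨u, 0, hu, fun a F m hm ↦ by simp at hm, ?_⟩
    rw [huz]
    ext1 F
    simp
  · intro H a ha
    set z : Finset V → (R.ι i →₀ MvPolynomial V k) :=
      fun F ↦ if F = ∅ then Finsupp.single a 1 else 0 with hzdef
    have hz : IsFreeChain (R.deg i) 0 j z := by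
      intro b F m h
      simp only [hzdef] at h
      split_ifs at h with hF
      · rw [Finsupp.single_apply] at h
        split_ifs at h with hab
        · rw [coeff_one] at h
          split_ifs at h with hm
          · subst hab hm
            simp [hF, ha]
          · exact absurd rfl h
        · simp at h
      · simp at h
    obtain ⟨u, y, -, -, huy⟩ := H z hz fun F ↦ by
      rw [hz.koszul_zero]; exact zero_mem _
    have h1 := congrArg (fun x ↦ coeff 0 (x ∅ a)) huy
    simp only [hzdef, if_true, Finsupp.single_eq_same, coeff_zero_one, Pi.add_apply,
      Finsupp.add_apply, coeff_add, coeff_zero_apply (R.minimal i), add_zero,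
      koszul_finsupp_apply] at h1
    obtain ⟨v, -, n, hn, -⟩ := exists_of_coeff_koszul_ne_zero (h1 ▸ one_ne_zero)
    have := DFunLike.congr_fun hn v
    simp at this
    omega

/-- The Betti numbers of `I` are read off from the Koszul homology of `S / I`. -/
theorem betti_eq_zero_iff_koszul (hI : I ≤ mIdeal k V) (i j : ℕ) :
    R.betti i j = 0 ↔ ∀ z, IsChain (i + 1) j z → (∀ F, koszul k z F ∈ I) →
      ∃ u, IsChain (i + 2) j u ∧ ∀ F, z F - koszul k u F ∈ I := by
  have := R.finite
  set f : (R.ι 0 →₀ MvPolynomial V k) →ₗ[MvPolynomial V k] (Unit →₀ MvPolynomial V k) :=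
    (Finsupp.lsingle ()) ∘ₗ R.aug with hf
  have hfa (x) : f x () = R.aug x := by simp [hf]
  have hrange (p : Unit →₀ MvPolynomial V k) : p ∈ LinearMap.range f ↔ p () ∈ I := by
    constructor
    · rintro ⟨x, rfl⟩
      exact R.aug_range.le ⟨x, (hfa x).symm⟩
    · intro hp
      obtain ⟨x, hx⟩ := R.aug_range.ge hp
      exact ⟨x, Finsupp.ext fun _ ↦ (hfa x).trans hx⟩
  have hgr : IsGraded (R.deg 0) (fun _ : Unit ↦ 0) f := by
    intro a b m h
    rw [hfa] at h
    rw [zero_add, Finsupp.degree_eq_weight_one]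
    exact (R.aug_homog a h).symm
  have hex : LinearMap.range (R.d 0) = LinearMap.ker f := by
    rw [R.exact_zero]
    ext x
    simp [hf]
  have hmin (a) (b : Unit) : f (Finsupp.single a 1) b ∈ mIdeal k V :=
    hI ((hrange _).1 ⟨_, rfl⟩)
  rw [betti_eq_zero_iff_cokerAcyclic, cokerAcyclic_d_iff, add_zero,
    ← cokerAcyclic_succ_iff hgr (R.isGraded_d 0) hex hmin]
  constructor
  · intro H z hz hzI
    obtain ⟨u, y, hu, -, h⟩ := H (fun F ↦ Finsupp.single () (z F))
      (fun _ ↦ by simpa using hz) (fun F ↦ by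
        rw [hrange, koszul_finsupp_apply]
        simpa using hzI F)
    refine ⟨fun F ↦ u F (), by simpa using hu (), fun F ↦ ?_⟩
    have h1 := congrArg (fun x ↦ x F ()) h
    simp only [Finsupp.single_eq_same, Pi.add_apply, Finsupp.add_apply,
      koszul_finsupp_apply] at h1
    rw [h1, add_sub_cancel_left, ← hrange]
    exact LinearMap.mem_range_self _ _
  · intro H z hz hzI
    obtain ⟨u, hu, h⟩ := H (fun F ↦ z F ()) (by simpa using hz ()) (fun F ↦ by
      rw [← koszul_finsupp_apply, ← hrange]
      exact hzI F)
    have hu' : IsFreeChain (fun _ : Unit ↦ 0) (i + 1 + 1) j fun F ↦ Finsupp.single () (u F) :=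
      fun _ ↦ by simpa using hu
    obtain ⟨y, hy, hyz⟩ := (hz.sub hu'.koszul).exists_lift hgr (by
      intro F
      rw [hrange, Pi.sub_apply, Finsupp.sub_apply, koszul_finsupp_apply]
      simpa using h F)
    exact ⟨_, y, hu', hy, by rw [hyz]; abel⟩

end MinFreeRes

end

end FreeModule

end WOG

namespace WOG

section MonomialIdeal

variable {V k : Type} [Field k]

/-- The monomial ideal spanned by the monomials with exponent in `P`. -/
def monIdeal (k : Type) [Field k] (P : UpperSet (V →₀ ℕ)) : Ideal (MvPolynomial V k) where
  carrier := {p | ∀ m, coeff m p ≠ 0 → m ∈ P}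
  zero_mem' m h := by simp at h
  add_mem' {p q} hp hq m h := by
    by_cases h' : coeff m p = 0
    · exact hq m fun h₂ ↦ h (by simp [h', h₂])
    · exact hp m h'
  smul_mem' c p hp m h := by
    classical
    rw [smul_eq_mul, coeff_mul] at h
    obtain ⟨x, hx, h⟩ := Finset.exists_ne_zero_of_sum_ne_zero h
    refine P.upper ?_ (hp x.2 (right_ne_zero_of_mul h))
    rw [← Finset.HasAntidiagonal.mem_antidiagonal.1 hx]
    exact le_add_self

lemma mem_monIdeal {P : UpperSet (V →₀ ℕ)} {p : MvPolynomial V k} :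
    p ∈ monIdeal k P ↔ ∀ m, coeff m p ≠ 0 → m ∈ P :=
  Iff.rfl

lemma monomial_mul_mem_monIdeal {P : UpperSet (V →₀ ℕ)} {s : V →₀ ℕ} {p : MvPolynomial V k} :
    monomial s 1 * p ∈ monIdeal k P ↔ ∀ m, coeff m p ≠ 0 → s + m ∈ P := by
  rw [mem_monIdeal]
  constructor
  · intro h m hm
    exact h _ (by rwa [coeff_monomial_mul, one_mul])
  · intro h m hm
    rw [coeff_monomial_mul'] at hm
    split_ifs at hm with hs
    · rw [← add_tsub_cancel_of_le hs]
      exact h _ (by simpa using hm)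
    · exact absurd rfl hm

/-- Reduction modulo the ideal `P` of an element of the ideal generated by `P` and `s`. -/
lemma sub_monomial_mul_divHom_mem {P Q : UpperSet (V →₀ ℕ)} {s : V →₀ ℕ}
    (hQ : ∀ m, m ∈ Q ↔ s ≤ m ∨ m ∈ P) {p : MvPolynomial V k} (hp : p ∈ monIdeal k Q) :
    p - monomial s 1 * divHom s p ∈ monIdeal k P := by
  intro m hm
  rw [coeff_sub, coeff_monomial_mul', coeff_divHom] at hm
  split_ifs at hm with hs
  · simp [add_tsub_cancel_of_le hs] at hm
  · exact ((hQ m).1 (hp m (by simpa using hm))).resolve_left hs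

lemma monIdeal_mono {P Q : UpperSet (V →₀ ℕ)} (h : ∀ m ∈ P, m ∈ Q) :
    monIdeal k P ≤ monIdeal k Q :=
  fun _ hp m hm ↦ h m (hp m hm)

lemma monomial_mul_mem_of_le {Q : UpperSet (V →₀ ℕ)} {s : V →₀ ℕ} (hQ : ∀ m, s ≤ m → m ∈ Q)
    (p : MvPolynomial V k) : monomial s 1 * p ∈ monIdeal k Q :=
  monomial_mul_mem_monIdeal.2 fun _ _ ↦ hQ _ le_self_add

lemma IsChain.divHom {q : ℕ} {j : ℤ} {z : Finset V → MvPolynomial V k} (hz : IsChain q j z)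
    (s : V →₀ ℕ) : IsChain q (j - s.degree) fun F ↦ divHom s (z F) := by
  intro F m h
  rw [coeff_divHom] at h
  obtain ⟨h1, h2⟩ := hz F _ h
  rw [map_add, Nat.cast_add] at h2
  exact ⟨h1, by omega⟩

lemma IsChain.monomial_smul {q : ℕ} {j : ℤ} {s : V →₀ ℕ} {z : Finset V → MvPolynomial V k}
    (hz : IsChain q (j - s.degree) z) :
    IsChain q j ((monomial s 1 : MvPolynomial V k) • z) := by
  intro F m h
  rw [Pi.smul_apply, smul_eq_mul, coeff_monomial_mul'] at h
  split_ifs at h with hs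
  · obtain ⟨h1, h2⟩ := hz F _ (by simpa using h)
    have := congrArg Finsupp.degree (add_tsub_cancel_of_le hs)
    rw [map_add] at this
    exact ⟨h1, by omega⟩
  · exact absurd rfl h

variable [Fintype V] [LinearOrder V]

lemma koszul_mem {I : Ideal (MvPolynomial V k)} {z : Finset V → MvPolynomial V k}
    (hz : ∀ F, z F ∈ I) (F : Finset V) : koszul k z F ∈ I :=
  I.sum_mem fun _ _ ↦ I.smul_mem _ (hz _)

/-- The regularity of `S / I` is at most `r`, in terms of Koszul homology, where `I` is the
monomial ideal of `P`. -/
def RegLE (k : Type) [Field k] (P : UpperSet (V →₀ ℕ)) (r : ℕ) : Prop :=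
  ∀ (q : ℕ) (j : ℤ) (z : Finset V → MvPolynomial V k), IsChain q j z →
    (∀ F, koszul k z F ∈ monIdeal k P) → (r : ℤ) < j - q →
    ∃ u, IsChain (q + 1) j u ∧ ∀ F, z F - koszul k u F ∈ monIdeal k P

lemma regLE_top : RegLE k (⊤ : UpperSet (V →₀ ℕ)) 0 := by
  intro q j z hz hk hr
  obtain ⟨u, hu, rfl⟩ := exists_koszul_eq hz (by
    ext F m
    by_contra h
    exact UpperSet.notMem_top (hk F m h)) (by
    by_contra h
    have := (hz ∅ 0 h).2
    simp at this
    omega)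
  exact ⟨u, hu, fun F ↦ by simp⟩

lemma koszul_monomial_smul (s : V →₀ ℕ) (z : Finset V → MvPolynomial V k) (F : Finset V) :
    koszul k ((monomial s 1 : MvPolynomial V k) • z) F = monomial s 1 * koszul k z F := by
  rw [map_smul, Pi.smul_apply, smul_eq_mul]

/-- Adding a monomial which is a nonzerodivisor. -/
theorem RegLE.add_regular {P Q : UpperSet (V →₀ ℕ)} {s : V →₀ ℕ} {r r' : ℕ} (h : RegLE k P r)
    (hQ : ∀ m, m ∈ Q ↔ s ≤ m ∨ m ∈ P) (hs : ∀ m, s + m ∈ P → m ∈ P)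
    (hr : r ≤ r') (hd : r + s.degree ≤ r' + 1) : RegLE k Q r' := by
  have hle : monIdeal k P ≤ monIdeal k Q := monIdeal_mono fun m hm ↦ (hQ m).2 (Or.inr hm)
  have hsQ := monomial_mul_mem_of_le (k := k) fun m hm ↦ (hQ m).2 (Or.inl hm)
  intro q j z hz hzQ hlt
  rcases q with _ | q
  · obtain ⟨u, hu, hzu⟩ := h 0 j z hz (fun F ↦ by simp [hz.koszul_zero]) (by omega)
    exact ⟨u, hu, fun F ↦ hle (hzu F)⟩
  set y : Finset V → MvPolynomial V k := fun F ↦ divHom s (koszul k z F) with hy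
  have hyc : IsChain q (j - s.degree) y := hz.koszul.divHom s
  have hmem (F : Finset V) : koszul k z F - monomial s 1 * y F ∈ monIdeal k P :=
    sub_monomial_mul_divHom_mem hQ (hzQ F)
  have hyP (F : Finset V) : koszul k y F ∈ monIdeal k P := by
    have h1 := koszul_mem (z := koszul k z - (monomial s 1 : MvPolynomial V k) • y) hmem F
    rw [map_sub, koszul_koszul, zero_sub, Pi.neg_apply, koszul_monomial_smul, neg_mem_iff,
      monomial_mul_mem_monIdeal] at h1
    exact fun m hm ↦ hs m (h1 m hm)
  obtain ⟨x, hx, hxy⟩ := h q _ y hyc hyP (by push_cast at hlt; omega)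
  obtain ⟨u, hu, huz⟩ := h (q + 1) j (z - (monomial s 1 : MvPolynomial V k) • x)
    (hz.sub hx.monomial_smul) (fun F ↦ by
      rw [map_sub, Pi.sub_apply, koszul_monomial_smul]
      have := add_mem (hmem F) (Ideal.mul_mem_left _ (monomial s 1) (hxy F))
      convert! this using 1
      ring) (by push_cast at hlt ⊢; omega)
  refine ⟨u, hu, fun F ↦ ?_⟩
  have := add_mem (hle (huz F)) (hsQ (x F))
  convert! this using 1
  simp only [Pi.sub_apply, Pi.smul_apply, smul_eq_mul]
  ring

/-- The exact sequence `0 → S / (I : f) → S / I → S / (I + f) → 0` for a monomial `f`. -/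
theorem RegLE.of_colon {P P' Q : UpperSet (V →₀ ℕ)} {s : V →₀ ℕ} {r r' : ℕ} (h : RegLE k Q r)
    (h' : RegLE k P' r') (hQ : ∀ m, m ∈ Q ↔ s ≤ m ∨ m ∈ P) (hs : ∀ m, s + m ∈ P ↔ m ∈ P')
    (hr : r' + s.degree ≤ r) : RegLE k P r := by
  have hle : monIdeal k P ≤ monIdeal k Q := monIdeal_mono fun m hm ↦ (hQ m).2 (Or.inr hm)
  have hcolon (p : MvPolynomial V k) : monomial s 1 * p ∈ monIdeal k P ↔ p ∈ monIdeal k P' := by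
    rw [monomial_mul_mem_monIdeal, mem_monIdeal]
    simp only [hs]
  intro q j z hz hzP hlt
  obtain ⟨u, hu, huz⟩ := h q j z hz (fun F ↦ hle (hzP F)) hlt
  set y : Finset V → MvPolynomial V k := fun F ↦ divHom s (z F - koszul k u F) with hy
  have hyc : IsChain q (j - s.degree) y := (hz.sub hu.koszul).divHom s
  have hmem (F : Finset V) : z F - koszul k u F - monomial s 1 * y F ∈ monIdeal k P :=
    sub_monomial_mul_divHom_mem hQ (huz F)
  have hyP (F : Finset V) : koszul k y F ∈ monIdeal k P' := by
    have h1 := koszul_mem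
      (z := z - koszul k u - (monomial s 1 : MvPolynomial V k) • y) hmem F
    rw [map_sub, map_sub, koszul_koszul, sub_zero, Pi.sub_apply, koszul_monomial_smul] at h1
    rw [← hcolon]
    simpa using sub_mem (hzP F) h1
  obtain ⟨x, hx, hxy⟩ := h' q _ y hyc hyP (by omega)
  refine ⟨u + (monomial s 1 : MvPolynomial V k) • x, hu.add hx.monomial_smul, fun F ↦ ?_⟩
  have := add_mem (hmem F) ((hcolon _).2 (hxy F))
  convert! this using 1
  rw [map_add, Pi.add_apply, koszul_monomial_smul]
  ring

/-- Exponents of the monomials divisible by some variable in `W`. -/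
def varUpper (W : Finset V) : UpperSet (V →₀ ℕ) where
  carrier := {m | ∃ x ∈ W, m x ≠ 0}
  upper' m n hmn := by
    rintro ⟨x, hx, h⟩
    exact ⟨x, hx, by have := hmn x; omega⟩

omit [Fintype V] [LinearOrder V] in
lemma mem_varUpper {W : Finset V} {m : V →₀ ℕ} : m ∈ varUpper W ↔ ∃ x ∈ W, m x ≠ 0 := Iff.rfl

lemma RegLE.add_variables {P : UpperSet (V →₀ ℕ)} {r : ℕ} (h : RegLE k P r) (W : Finset V)
    (hW : ∀ x ∈ W, ∀ m, Finsupp.single x 1 + m ∈ P → m ∈ P) :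
    RegLE k (P ⊓ varUpper W) r := by
  induction W using Finset.induction_on with
  | empty =>
    convert! h using 1
    ext m
    simp [mem_varUpper]
  | insert x W hx ih =>
    refine (ih fun y hy ↦ hW y (Finset.mem_insert_of_mem hy)).add_regular
      (s := Finsupp.single x 1) ?_ ?_ le_rfl (by simp)
    · intro m
      simp only [UpperSet.mem_inf_iff, mem_varUpper, Finset.exists_mem_insert,
        Finsupp.single_le_iff, Nat.one_le_iff_ne_zero]
      tauto
    · rintro m (hm | ⟨y, hy, hm⟩)
      · exact Or.inl (hW x (Finset.mem_insert_self _ _) m hm)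
      · refine Or.inr ⟨y, hy, ?_⟩
        have : x ≠ y := by rintro rfl; exact hx hy
        simpa [Finsupp.single_eq_of_ne this.symm] using hm

end MonomialIdeal

end WOG

namespace WOG

section UpperBound

variable {V k : Type} [Field k] {part : V → ℕ} (σ : {x : V // part x = 0} → V) (w : V → ℕ)

/-- Exponents of the monomials in the ideal generated by the matching edges ending in `B` and the
edges between consecutive layers ending in `U`. -/
def edgeUpper (B : Finset {x : V // part x = 0}) (U : Finset V) : UpperSet (V →₀ ℕ) where
  carrier := {m | (∃ a ∈ B, 1 ≤ m (σ a) ∧ w a ≤ m a) ∨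
    ∃ v ∈ U, ∃ u, 1 ≤ part u ∧ part v = part u + 1 ∧ 1 ≤ m u ∧ w v ≤ m v}
  upper' m n hmn := by
    rintro (⟨a, ha, h1, h2⟩ | ⟨v, hv, u, hu, huv, h1, h2⟩)
    · exact Or.inl ⟨a, ha, h1.trans (hmn _), h2.trans (hmn _)⟩
    · exact Or.inr ⟨v, hv, u, hu, huv, h1.trans (hmn _), h2.trans (hmn _)⟩

variable {σ w}

lemma mem_edgeUpper {B : Finset {x : V // part x = 0}} {U : Finset V} {m : V →₀ ℕ} :
    m ∈ edgeUpper σ w B U ↔ (∃ a ∈ B, 1 ≤ m (σ a) ∧ w a ≤ m a) ∨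
      ∃ v ∈ U, ∃ u, 1 ≤ part u ∧ part v = part u + 1 ∧ 1 ≤ m u ∧ w v ≤ m v :=
  Iff.rfl

lemma single_add_single_le_iff {u v : V} (huv : u ≠ v) {b c : ℕ} {m : V →₀ ℕ} :
    Finsupp.single u b + Finsupp.single v c ≤ m ↔ b ≤ m u ∧ c ≤ m v := by
  classical
  constructor
  · intro h
    have h1 := h u
    have h2 := h v
    simp [huv, huv.symm] at h1 h2
    exact ⟨h1, h2⟩
  · rintro ⟨h1, h2⟩ x
    rw [Finsupp.add_apply, Finsupp.single_apply, Finsupp.single_apply]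
    split_ifs with hu hv hv
    · exact absurd (hu.trans hv.symm) huv
    · subst hu; simpa using h1
    · subst hv; simpa using h2
    · simp

variable [Fintype V] [LinearOrder V]

lemma regLE_matching (hσinj : Function.Injective σ) (hσ : ∀ a, part (σ a) = 1)
    (B : Finset {x : V // part x = 0}) :
    RegLE k (edgeUpper σ w B ∅) (∑ a ∈ B, w a) := by
  have hne (a b : {x : V // part x = 0}) : σ a ≠ b := fun h ↦ by
    have h1 := hσ a
    rw [h, b.2] at h1
    omega
  induction B using Finset.induction_on with
  | empty =>
    have h : edgeUpper σ w ∅ ∅ = ⊤ := by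
      ext m
      simp [mem_edgeUpper]
    rw [h]
    simpa using regLE_top
  | insert a B ha ih =>
    rw [Finset.sum_insert ha]
    refine ih.add_regular (s := Finsupp.single (σ a) 1 + Finsupp.single (a : V) (w a))
      ?_ ?_ (by omega) ?_
    · intro m
      rw [single_add_single_le_iff (hne a a)]
      simp [mem_edgeUpper]
    · rintro m (⟨b, hb, h1, h2⟩ | ⟨v, hv, -⟩)
      · have hab : a ≠ b := by rintro rfl; exact ha hb
        have h3 : σ a ≠ σ b := fun h ↦ hab (hσinj h)
        have h4 : (a : V) ≠ b := fun h ↦ hab (Subtype.ext h)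
        refine Or.inl ⟨b, hb, ?_, ?_⟩
        · simpa [h3.symm, hne b a] using h1
        · simpa [h4.symm, (hne a b).symm] using h2
      · simp at hv
    · simp [Finsupp.degree_single]
      omega

omit [Fintype V] [LinearOrder V] in
/-- The colon ideal by the pure power of a vertex in the top layer. -/
lemma add_mem_edgeUpper_iff [Fintype {x : V // part x = 0}] (hσ : ∀ a, part (σ a) = 1)
    (hw : ∀ x, 1 ≤ w x) {U : Finset V} {v : V}
    (hv : v ∈ U) (hv2 : 2 ≤ part v) (hmax : ∀ x ∈ U, part x ≤ part v) {W : Finset V}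
    (hW : ∀ x, x ∈ W ↔ part x + 1 = part v) (m : V →₀ ℕ) :
    Finsupp.single v (w v) + m ∈ edgeUpper σ w Finset.univ U ↔
      m ∈ edgeUpper σ w Finset.univ (U.filter (part · + 1 < part v)) ⊓ varUpper W := by
  rw [UpperSet.mem_inf_iff, mem_varUpper]
  have hs {x : V} (hx : x ≠ v) : (Finsupp.single v (w v) + m) x = m x := by simp [hx]
  have hsv : (Finsupp.single v (w v) + m) v = w v + m v := by simp
  constructor
  · rintro (⟨a, ha, h1, h2⟩ | ⟨x, hx, u, hu, hxu, h1, h2⟩)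
    · have h3 : σ a ≠ v := by rintro rfl; have := hσ a; omega
      have h4 : (a : V) ≠ v := by rintro rfl; have := a.2; omega
      rw [hs h3] at h1
      rw [hs h4] at h2
      exact Or.inl (Or.inl ⟨a, ha, h1, h2⟩)
    · have hxm := hmax x hx
      have h3 : u ≠ v := by rintro rfl; omega
      rw [hs h3] at h1
      by_cases h4 : part x = part v
      · exact Or.inr ⟨u, (hW u).2 (by omega), by omega⟩
      · have h5 : x ≠ v := by rintro rfl; exact h4 rfl
        rw [hs h5] at h2
        by_cases h6 : part x + 1 = part v
        · exact Or.inr ⟨x, (hW x).2 h6, by have := hw x; omega⟩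
        · refine Or.inl (Or.inr ⟨x, ?_, u, hu, hxu, h1, h2⟩)
          exact Finset.mem_filter.2 ⟨hx, by omega⟩
  · rintro (h | ⟨x, hx, h⟩)
    · refine (edgeUpper σ w Finset.univ U).upper le_add_self ?_
      rcases h with h | ⟨x, hx, h⟩
      · exact Or.inl h
      · exact Or.inr ⟨x, (Finset.mem_filter.1 hx).1, h⟩
    · have hx := (hW x).1 hx
      refine Or.inr ⟨v, hv, x, by omega, by omega, ?_, ?_⟩
      · rw [hs (by rintro rfl; omega)]; omega
      · omega

/-- The regularity bound for the edges ending in a set `U` of vertices closed under passing to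
lower layers. -/
theorem regLE_edgeUpper [Fintype {x : V // part x = 0}] [Nonempty {x : V // part x = 0}]
    (hσinj : Function.Injective σ)
    (hσ : ∀ a, part (σ a) = 1) (hw : ∀ x, 1 ≤ w x)
    (hlayer : ∀ v, 3 ≤ part v → ∃ u, part u + 1 = part v ∧ 2 ≤ w u) (U : Finset V)
    (hU2 : ∀ v ∈ U, 2 ≤ part v) (hU : ∀ v ∈ U, ∀ u, 2 ≤ part u → part u < part v → u ∈ U) :
    RegLE k (edgeUpper σ w Finset.univ U)
      (∑ a : {x : V // part x = 0}, w a + ∑ v ∈ U, (w v - 1)) := by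
  induction U using Finset.strongInduction with
  | H U ih =>
    rcases U.eq_empty_or_nonempty with rfl | hne
    · simpa using regLE_matching hσinj hσ Finset.univ
    obtain ⟨v, hv, hmax⟩ := U.exists_max_image part hne
    have hv2 := hU2 v hv
    set r := ∑ a : {x : V // part x = 0}, w a + ∑ v ∈ U, (w v - 1) with hr
    have hsum : ∑ x ∈ U.erase v, (w x - 1) + (w v - 1) = ∑ x ∈ U, (w x - 1) :=
      Finset.sum_erase_add U _ hv
    have hwv := hw v
    have hQ (m : V →₀ ℕ) :
        m ∈ edgeUpper σ w Finset.univ (U.erase v) ⊓ UpperSet.Ici (Finsupp.single v (w v)) ↔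
          Finsupp.single v (w v) ≤ m ∨ m ∈ edgeUpper σ w Finset.univ (U.erase v) := by
      rw [UpperSet.mem_inf_iff, UpperSet.mem_Ici_iff, or_comm]
    have hreg : RegLE k
        (edgeUpper σ w Finset.univ (U.erase v) ⊓ UpperSet.Ici (Finsupp.single v (w v))) r := by
      refine (ih _ (Finset.erase_ssubset hv) (fun x hx ↦ hU2 x (Finset.mem_of_mem_erase hx))
        fun x hx u hu hux ↦ ?_).add_regular hQ ?_ (by omega) (by simp; omega)
      · have hx' := Finset.mem_of_mem_erase hx
        refine Finset.mem_erase.2 ⟨?_, hU x hx' u hu hux⟩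
        rintro rfl
        exact absurd (hmax x hx') (by omega)
      · have hs {m : V →₀ ℕ} {x : V} (hx : x ≠ v) :
            (Finsupp.single v (w v) + m) x = m x := by simp [hx]
        rintro m (⟨a, ha, h1, h2⟩ | ⟨x, hx, u, hu, hxu, h1, h2⟩)
        · rw [hs (by rintro rfl; have := hσ a; omega)] at h1
          rw [hs (by rintro rfl; have := a.2; omega)] at h2
          exact Or.inl ⟨a, ha, h1, h2⟩
        · have hxm := hmax x (Finset.mem_of_mem_erase hx)
          rw [hs (by rintro rfl; omega)] at h1
          rw [hs (Finset.ne_of_mem_erase hx)] at h2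
          exact Or.inr ⟨x, hx, u, hu, hxu, h1, h2⟩
    set W : Finset V := Finset.univ.filter (part · + 1 = part v) with hWdef
    have hW (x : V) : x ∈ W ↔ part x + 1 = part v := by simp [hWdef]
    have hcolon := add_mem_edgeUpper_iff hσ hw hv hv2 hmax hW
    have hQ' (m : V →₀ ℕ) :
        m ∈ edgeUpper σ w Finset.univ (U.erase v) ⊓ UpperSet.Ici (Finsupp.single v (w v)) ↔
          Finsupp.single v (w v) ≤ m ∨ m ∈ edgeUpper σ w Finset.univ U := by
      rw [hQ]
      constructor
      · rintro (h | h | ⟨x, hx, h⟩)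
        · exact Or.inl h
        · exact Or.inr (Or.inl h)
        · exact Or.inr (Or.inr ⟨x, Finset.mem_of_mem_erase hx, h⟩)
      · rintro (h | h | ⟨x, hx, u, h⟩)
        · exact Or.inl h
        · exact Or.inr (Or.inl h)
        · by_cases hxv : x = v
          · subst hxv
            exact Or.inl (Finsupp.single_le_iff.2 h.2.2.2)
          · exact Or.inr (Or.inr ⟨x, Finset.mem_erase.2 ⟨hxv, hx⟩, u, h⟩)
    by_cases hv3 : 3 ≤ part v
    · have hlt : U.filter (part · + 1 < part v) ⊂ U :=
        Finset.filter_ssubset.2 ⟨v, hv, by omega⟩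
      have hvars := (ih _ hlt (fun x hx ↦ hU2 x (Finset.mem_filter.1 hx).1)
        fun x hx u hu hux ↦ by
          rw [Finset.mem_filter] at hx ⊢
          exact ⟨hU x hx.1 u hu hux, by omega⟩).add_variables W (by
        intro y hy m
        have hy := (hW y).1 hy
        have hs {x : V} (hx : x ≠ y) : (Finsupp.single y 1 + m : V →₀ ℕ) x = m x := by
          simp [hx]
        rintro (⟨a, ha, h1, h2⟩ | ⟨x, hx, u, hu, hxu, h1, h2⟩)
        · rw [hs (by rintro rfl; have := hσ a; omega)] at h1
          rw [hs (by rintro rfl; have := a.2; omega)] at h2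
          exact Or.inl ⟨a, ha, h1, h2⟩
        · have hx' := (Finset.mem_filter.1 hx).2
          rw [hs (by rintro rfl; omega)] at h1
          rw [hs (by rintro rfl; omega)] at h2
          exact Or.inr ⟨x, hx, u, hu, hxu, h1, h2⟩)
      refine hreg.of_colon hvars hQ' hcolon ?_
      obtain ⟨u, hu, hwu⟩ := hlayer v hv3
      have huv : u ≠ v := by rintro rfl; omega
      have hle : ∑ x ∈ insert u (U.filter (part · + 1 < part v)), (w x - 1) ≤
          ∑ x ∈ U.erase v, (w x - 1) := by
        refine Finset.sum_le_sum_of_subset fun x hx ↦ ?_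
        rcases Finset.mem_insert.1 hx with rfl | hx
        · exact Finset.mem_erase.2 ⟨huv, hU v hv _ (by omega) (by omega)⟩
        · rw [Finset.mem_filter] at hx
          exact Finset.mem_erase.2 ⟨by rintro rfl; omega, hx.1⟩
      rw [Finset.sum_insert (by simp; omega)] at hle
      rw [Finsupp.degree_single]
      omega
    · have hvars := (regLE_top (V := V) (k := k)).add_variables W
        fun x _ m hm ↦ absurd hm UpperSet.notMem_top
      refine hreg.of_colon (P' := ⊤ ⊓ varUpper W) hvars hQ' (fun m ↦ ?_) ?_
      · rw [hcolon, UpperSet.mem_inf_iff, UpperSet.mem_inf_iff]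
        constructor
        · rintro ((⟨a, ha, h1, h2⟩ | ⟨x, hx, -⟩) | h)
          · exact Or.inr ⟨σ a, (hW _).2 (by have := hσ a; omega), by omega⟩
          · rw [Finset.mem_filter] at hx
            have := hU2 x hx.1
            omega
          · exact Or.inr h
        · rintro (h | h)
          · exact absurd h UpperSet.notMem_top
          · exact Or.inr h
      · obtain ⟨a⟩ := ‹Nonempty {x : V // part x = 0}›
        have h1 := Finset.single_le_sum (f := fun a : {x : V // part x = 0} ↦ w a)
          (fun _ _ ↦ Nat.zero_le _) (Finset.mem_univ a)
        have h2 := hw a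
        rw [Finsupp.degree_single]
        beta_reduce at h1
        omega

end UpperBound

end WOG

namespace WOG

section LowerBound

variable {V k : Type} [Field k] [Fintype V] [LinearOrder V]

/-- The exponent obtained from `b` by lowering the entries in `F` by one. -/
def lowerExp (b : V → ℕ) (F : Finset V) : V →₀ ℕ :=
  Finsupp.equivFunOnFinite.symm fun v ↦ b v - if v ∈ F then 1 else 0

lemma lowerExp_apply (b : V → ℕ) (F : Finset V) (v : V) :
    lowerExp b F v = b v - if v ∈ F then 1 else 0 :=
  rfl

lemma coeff_lowerExp_X_mul {b : V → ℕ} {F : Finset V} {v : V} (hv : v ∉ F)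
    (p : MvPolynomial V k) :
    coeff (lowerExp b F) (X v * p) =
      if b v = 0 then 0 else coeff (lowerExp b (insert v F)) p := by
  rw [coeff_X_mul']
  by_cases hb : b v = 0
  · simp [lowerExp_apply, hv, hb]
  · rw [if_pos (by simp [lowerExp_apply, hv, hb]), if_neg hb]
    congr 1
    ext x
    rw [Finsupp.tsub_apply, lowerExp_apply, lowerExp_apply]
    by_cases hx : x = v
    · subst hx; simp [hv]
    · simp [hx]

variable {part : V → ℕ} (σ : {x : V // part x = 0} → V) (w : V → ℕ)

/-- The exponent of the monomial supporting the extremal Koszul cycle. -/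
def topExp (v : V) : ℕ :=
  open Classical in if part v ≠ 1 then w v else if v ∈ Set.range σ then 1 else 0

/-- The vertices outside the first two layers, together with one endpoint of each matching edge:
the tail for the edges in `A` and the head for the others. -/
def transversal (A : Finset {x : V // part x = 0}) : Finset V :=
  open Classical in Finset.univ.filter fun v ↦
    2 ≤ part v ∨ (∃ a, a ∉ A ∧ v = a) ∨ ∃ a ∈ A, v = σ a

variable {σ w}

lemma mem_transversal {A : Finset {x : V // part x = 0}} {v : V} :
    v ∈ transversal σ A ↔ 2 ≤ part v ∨ (∃ a, a ∉ A ∧ v = a) ∨ ∃ a ∈ A, v = σ a := by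
  simp [transversal]

lemma mem_transversal_of_part_eq_zero (hσ : ∀ a, part (σ a) = 1)
    {A : Finset {x : V // part x = 0}} (a : {x : V // part x = 0}) :
    (a : V) ∈ transversal σ A ↔ a ∉ A := by
  rw [mem_transversal]
  constructor
  · rintro (h | ⟨b, hb, h⟩ | ⟨b, -, h⟩)
    · have := a.2; omega
    · rwa [Subtype.ext h]
    · have h1 := a.2
      rw [h, hσ b] at h1
      omega
  · exact fun h ↦ Or.inr (Or.inl ⟨a, h, rfl⟩)

lemma apply_mem_transversal (hσinj : Function.Injective σ) (hσ : ∀ a, part (σ a) = 1)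
    {A : Finset {x : V // part x = 0}} (a : {x : V // part x = 0}) :
    σ a ∈ transversal σ A ↔ a ∈ A := by
  rw [mem_transversal]
  have h1 := hσ a
  constructor
  · rintro (h | ⟨b, -, h⟩ | ⟨b, hb, h⟩)
    · omega
    · rw [h, b.2] at h1
      omega
    · rwa [hσinj h]
  · exact fun h ↦ Or.inr (Or.inr ⟨a, h, rfl⟩)

lemma notMem_transversal_iff (hσinj : Function.Injective σ) (hσ : ∀ a, part (σ a) = 1)
    {A : Finset {x : V // part x = 0}} {v : V} :
    v ∉ transversal σ A ↔ (∃ a ∈ A, v = a) ∨ (∃ a, a ∉ A ∧ v = σ a) ∨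
      (part v = 1 ∧ v ∉ Set.range σ) := by
  constructor
  · intro h
    have h2 : ¬ 2 ≤ part v := fun h' ↦ h (mem_transversal.2 (Or.inl h'))
    by_cases h0 : part v = 0
    · refine Or.inl ⟨⟨v, h0⟩, ?_, rfl⟩
      by_contra h'
      exact h ((mem_transversal_of_part_eq_zero hσ ⟨v, h0⟩).2 h')
    · refine Or.inr ?_
      by_cases hr : v ∈ Set.range σ
      · obtain ⟨a, rfl⟩ := hr
        exact Or.inl ⟨a, fun ha ↦ h ((apply_mem_transversal hσinj hσ a).2 ha), rfl⟩
      · exact Or.inr ⟨by omega, hr⟩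
  · rintro (⟨a, ha, rfl⟩ | ⟨a, ha, rfl⟩ | ⟨h1, hr⟩)
    · rw [mem_transversal_of_part_eq_zero hσ]; exact not_not.2 ha
    · rwa [apply_mem_transversal hσinj hσ]
    · rw [mem_transversal]
      rintro (h | ⟨a, -, rfl⟩ | ⟨a, -, rfl⟩)
      · omega
      · have := a.2; omega
      · exact hr ⟨a, rfl⟩

section Functional

variable [Fintype {x : V // part x = 0}]

variable (k) in
/-- A linear functional on Koszul chains detecting the extremal cycle. -/
def cycleFunctional (σ : {x : V // part x = 0} → V) (w : V → ℕ)
    (y : Finset V → MvPolynomial V k) : k :=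
  ∑ A : Finset {x : V // part x = 0},
    coeff (lowerExp (topExp σ w) (transversal σ A)) (y (transversal σ A))

lemma sum_compl_transversal {M : Type*} [AddCommMonoid M] (hσinj : Function.Injective σ)
    (hσ : ∀ a, part (σ a) = 1)
    (A : Finset {x : V // part x = 0}) (f : V → M)
    (hf : ∀ v, part v = 1 → v ∉ Set.range σ → f v = 0) :
    ∑ v ∈ (transversal σ A)ᶜ, f v =
      ∑ a : {x : V // part x = 0}, f (if a ∈ A then (a : V) else σ a) := by
  have hne (a b : {x : V // part x = 0}) : σ a ≠ b := fun h ↦ by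
    have h1 := hσ a
    rw [h, b.2] at h1
    omega
  symm
  refine Finset.sum_of_injOn (fun a ↦ if a ∈ A then (a : V) else σ a) ?_ ?_ ?_ fun _ _ ↦ rfl
  · intro a _ b _ h
    dsimp only at h
    split_ifs at h
    · exact Subtype.ext h
    · exact absurd h.symm (hne b a)
    · exact absurd h (hne a b)
    · exact hσinj h
  · intro a _
    rw [Finset.mem_coe, Finset.mem_compl, notMem_transversal_iff hσinj hσ]
    dsimp only
    split_ifs with h
    · exact Or.inl ⟨a, h, rfl⟩
    · exact Or.inr (Or.inl ⟨a, h, rfl⟩)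
  · intro v hv hv'
    rw [Finset.mem_compl, notMem_transversal_iff hσinj hσ] at hv
    rcases hv with ⟨a, ha, rfl⟩ | ⟨a, ha, rfl⟩ | ⟨h1, hr⟩
    · exact absurd ⟨a, by simp, by simp [ha]⟩ hv'
    · exact absurd ⟨a, by simp, by simp [ha]⟩ hv'
    · exact hf v h1 hr

lemma cycleFunctional_koszul (hσinj : Function.Injective σ) (hσ : ∀ a, part (σ a) = 1)
    (hw : ∀ x, 1 ≤ w x) (hlt : ∀ a : {x : V // part x = 0}, (a : V) < σ a)
    (hadj : ∀ (a : {x : V // part x = 0}) (x : V), x ≠ a → x ≠ σ a → (x < a ↔ x < σ a))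
    (u : Finset V → MvPolynomial V k) : cycleFunctional k σ w (koszul k u) = 0 := by
  set b := topExp σ w with hb
  have hb0 (a : {x : V // part x = 0}) : b a ≠ 0 := by
    have := hw a
    simp [hb, topExp, a.2]
    omega
  have hb1 (a : {x : V // part x = 0}) : b (σ a) ≠ 0 := by
    simp [hb, topExp, hσ]
  set f : Finset {x : V // part x = 0} → V → k := fun A v ↦
    koszulSign v (transversal σ A) * if b v = 0 then 0 else
      coeff (lowerExp b (insert v (transversal σ A))) (u (insert v (transversal σ A))) with hf
  have h1 (A : Finset {x : V // part x = 0}) :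
      coeff (lowerExp b (transversal σ A)) (koszul k u (transversal σ A)) =
        ∑ a, f A (if a ∈ A then (a : V) else σ a) := by
    rw [← sum_compl_transversal hσinj hσ A (f A), koszul_apply, coeff_sum]
    · refine Finset.sum_congr rfl fun v hv ↦ ?_
      rw [smul_eq_mul, mul_assoc, coeff_intCast_mul,
        coeff_lowerExp_X_mul (Finset.mem_compl.1 hv)]
    · intro v hv hr
      have : b v = 0 := by simp [hb, topExp, hv, hr]
      simp [hf, this]
  have key (a : {x : V // part x = 0}) (A : Finset {x : V // part x = 0}) (ha : a ∉ A) :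
      f A (σ a) + f (insert a A) a = 0 := by
    have hne : σ a ≠ a := (hlt a).ne'
    set G := (transversal σ A).erase a with hG
    have haA : (a : V) ∈ transversal σ A := (mem_transversal_of_part_eq_zero hσ a).2 ha
    have hsA : σ a ∉ transversal σ A := fun h ↦ ha ((apply_mem_transversal hσinj hσ a).1 h)
    have hGA : transversal σ A = insert (a : V) G := (Finset.insert_erase haA).symm
    have haG : (a : V) ∉ G := Finset.notMem_erase _ _
    have hsG : σ a ∉ G := fun h ↦ hsA (Finset.mem_of_mem_erase h)
    have hGA' : transversal σ (insert a A) = insert (σ a) G := by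
      ext v
      rw [Finset.mem_insert, hG, Finset.mem_erase, mem_transversal, mem_transversal]
      constructor
      · rintro (h | ⟨c, hc, rfl⟩ | ⟨c, hc, rfl⟩)
        · exact Or.inr ⟨by rintro rfl; have := a.2; omega, Or.inl h⟩
        · rw [Finset.mem_insert, not_or] at hc
          exact Or.inr ⟨fun h ↦ hc.1 (Subtype.ext h), Or.inr (Or.inl ⟨c, hc.2, rfl⟩)⟩
        · rcases Finset.mem_insert.1 hc with rfl | hc
          · exact Or.inl rfl
          · refine Or.inr ⟨fun h ↦ ?_, Or.inr (Or.inr ⟨c, hc, rfl⟩)⟩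
            have h2 := hσ c
            rw [h, a.2] at h2
            omega
      · rintro (rfl | ⟨hva, h | ⟨c, hc, rfl⟩ | ⟨c, hc, rfl⟩⟩)
        · exact Or.inr (Or.inr ⟨a, Finset.mem_insert_self _ _, rfl⟩)
        · exact Or.inl h
        · refine Or.inr (Or.inl ⟨c, ?_, rfl⟩)
          rw [Finset.mem_insert, not_or]
          exact ⟨fun h ↦ hva (congrArg _ h), hc⟩
        · exact Or.inr (Or.inr ⟨c, Finset.mem_insert_of_mem hc, rfl⟩)
    have hsign : koszulSign (a : V) G = koszulSign (σ a) G := by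
      unfold koszulSign
      congr 2
      refine Finset.filter_congr fun x hx ↦ hadj a x ?_ ?_
      · rintro rfl; exact haG hx
      · rintro rfl; exact hsG hx
    simp only [hf, hGA, hGA', if_neg (hb0 a), if_neg (hb1 a)]
    rw [koszulSign_insert haG, koszulSign_insert hsG, if_pos (hlt a), if_neg (hlt a).not_gt,
      hsign, Finset.insert_comm]
    push_cast
    ring
  unfold cycleFunctional
  rw [← hb, Finset.sum_congr rfl fun A _ ↦ h1 A, Finset.sum_comm]
  refine Finset.sum_eq_zero fun a _ ↦ ?_
  have hbij : ∑ A with a ∈ A, f A (if a ∈ A then (a : V) else σ a) =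
      ∑ A with a ∉ A, f (insert a A) a := by
    refine Finset.sum_nbij' (fun A ↦ A.erase a) (fun A ↦ insert a A) ?_ ?_ ?_ ?_ ?_
    · simp
    · simp
    · intro A hA
      exact Finset.insert_erase (Finset.mem_filter.1 hA).2
    · intro A hA
      exact Finset.erase_insert (Finset.mem_filter.1 hA).2
    · intro A hA
      have ha := (Finset.mem_filter.1 hA).2
      rw [if_pos ha, Finset.insert_erase ha]
  rw [← Finset.sum_filter_add_sum_filter_not _ (fun A ↦ a ∈ A), hbij,
    ← Finset.sum_add_distrib]
  refine Finset.sum_eq_zero fun A hA ↦ ?_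
  have ha := (Finset.mem_filter.1 hA).2
  rw [if_neg ha, add_comm]
  exact key a A ha

/-- The monomials appearing in the functional lie outside the ideal. -/
lemma lowerExp_notMem_edgeUpper (hσinj : Function.Injective σ) (hσ : ∀ a, part (σ a) = 1)
    (hw : ∀ x, 1 ≤ w x)
    {U : Finset V} (hU : ∀ v ∈ U, 2 ≤ part v) (A : Finset {x : V // part x = 0}) :
    lowerExp (topExp σ w) (transversal σ A) ∉ edgeUpper σ w Finset.univ U := by
  rintro (⟨a, -, h1, h2⟩ | ⟨v, hv, u, -, -, -, h2⟩)
  · by_cases ha : a ∈ A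
    · have := (apply_mem_transversal hσinj hσ a).2 ha
      simp [lowerExp_apply, this, topExp, hσ] at h1
    · have := (mem_transversal_of_part_eq_zero hσ (A := A) a).2 ha
      have hwa := hw a
      simp [lowerExp_apply, this, topExp, a.2] at h2
      omega
  · have hv2 := hU v hv
    have h3 : v ∈ transversal σ A := mem_transversal.2 (Or.inl hv2)
    have h4 : part v ≠ 1 := by omega
    have hwv := hw v
    simp [lowerExp_apply, h3, topExp, h4] at h2
    omega

lemma degree_lowerExp (hσinj : Function.Injective σ) (hσ : ∀ a, part (σ a) = 1)
    (hw : ∀ x, 1 ≤ w x) :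
    (lowerExp (topExp σ w) (transversal σ ∅)).degree =
      ∑ a : {x : V // part x = 0}, w a + ∑ v with 2 ≤ part v, (w v - 1) := by
  rw [Finsupp.degree_eq_sum, ← Finset.sum_add_sum_compl (transversal σ ∅),
    ← Finset.sum_filter_add_sum_filter_not (transversal σ ∅) (2 ≤ part ·),
    sum_compl_transversal hσinj hσ]
  · have h1 : (transversal σ ∅).filter (2 ≤ part ·) = Finset.univ.filter (2 ≤ part ·) := by
      ext v
      simp only [Finset.mem_filter, mem_transversal, Finset.mem_univ, true_and]
      tauto
    have h2 (v : V) : v ∈ (transversal σ ∅).filter (¬ 2 ≤ part ·) ↔ part v = 0 := by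
      rw [Finset.mem_filter]
      constructor
      · rintro ⟨hv, hv2⟩
        rcases mem_transversal.1 hv with h | ⟨a, -, rfl⟩ | ⟨a, ha, -⟩
        · exact absurd h hv2
        · exact a.2
        · simp at ha
      · intro h
        exact ⟨(mem_transversal_of_part_eq_zero hσ ⟨v, h⟩).2 (Finset.notMem_empty _), by omega⟩
    rw [h1, Finset.sum_subtype _ h2, add_assoc, ← Finset.sum_add_distrib, add_comm]
    congr 1
    · refine Finset.sum_congr rfl fun a _ ↦ ?_
      have h3 := (mem_transversal_of_part_eq_zero hσ a).2 (Finset.notMem_empty a)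
      have h4 : σ a ∉ transversal σ ∅ := by simp [apply_mem_transversal hσinj hσ]
      have hwa := hw a
      simp [lowerExp_apply, h3, h4, topExp, a.2, hσ]
      omega
    · refine Finset.sum_congr rfl fun v hv ↦ ?_
      have hv2 := (Finset.mem_filter.1 hv).2
      have h3 : v ∈ transversal σ ∅ := mem_transversal.2 (Or.inl hv2)
      have h4 : part v ≠ 1 := by omega
      simp [lowerExp_apply, h3, topExp, h4]
  · intro v hv hr
    simp [lowerExp_apply, topExp, hv, hr]

/-- Multiplying the extremal monomial by a vertex of its transversal leads into the ideal. -/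
lemma single_add_lowerExp_mem [Nonempty {x : V // part x = 0}]
    (hσinj : Function.Injective σ) (hσ : ∀ a, part (σ a) = 1) (hw : ∀ x, 1 ≤ w x)
    (hlayer : ∀ v, 3 ≤ part v → ∃ u, part u + 1 = part v ∧ 2 ≤ w u) {U : Finset V}
    (hU : ∀ v, 2 ≤ part v → v ∈ U) {v : V} (hv : v ∈ transversal σ ∅) :
    Finsupp.single v 1 + lowerExp (topExp σ w) (transversal σ ∅) ∈
      edgeUpper σ w Finset.univ U := by
  have hs (a : {x : V // part x = 0}) :
      lowerExp (topExp σ w) (transversal σ ∅) (σ a) = 1 := by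
    have h : σ a ∉ transversal σ ∅ := by simp [apply_mem_transversal hσinj hσ]
    simp [lowerExp_apply, h, topExp, hσ]
  have hself (h1 : part v ≠ 1) :
      (Finsupp.single v 1 + lowerExp (topExp σ w) (transversal σ ∅) : V →₀ ℕ) v = w v := by
    have := hw v
    simp [lowerExp_apply, hv, topExp, h1]
    omega
  rcases mem_transversal.1 hv with h | ⟨a, -, rfl⟩ | ⟨a, ha, -⟩
  · refine Or.inr ⟨v, hU v h, ?_⟩
    rw [hself (by omega)]
    suffices ∃ u, part u + 1 = part v ∧
        1 ≤ lowerExp (topExp σ w) (transversal σ ∅) u by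
      obtain ⟨u, hu, h1⟩ := this
      exact ⟨u, by omega, hu.symm, h1.trans (by simp), le_rfl⟩
    by_cases h2 : part v = 2
    · obtain ⟨a⟩ := ‹Nonempty {x : V // part x = 0}›
      exact ⟨σ a, by rw [hσ a, h2], (hs a).ge⟩
    · obtain ⟨u, hu, hwu⟩ := hlayer v (by omega)
      refine ⟨u, hu, ?_⟩
      have hu2 : u ∈ transversal σ ∅ := mem_transversal.2 (Or.inl (by omega))
      have hu1 : part u ≠ 1 := by omega
      simp [lowerExp_apply, hu2, topExp, hu1]
      omega
  · refine Or.inl ⟨a, Finset.mem_univ a, ?_, ?_⟩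
    · rw [Finsupp.add_apply, hs a]
      omega
    · rw [hself (by have := a.2; omega)]
  · simp at ha

/-- The Koszul homology of the edge ideal is nonzero in the extremal degree. -/
theorem exists_extremal_cycle [Nonempty {x : V // part x = 0}]
    (hσinj : Function.Injective σ) (hσ : ∀ a, part (σ a) = 1) (hw : ∀ x, 1 ≤ w x)
    (hlayer : ∀ v, 3 ≤ part v → ∃ u, part u + 1 = part v ∧ 2 ≤ w u)
    (hlt : ∀ a : {x : V // part x = 0}, (a : V) < σ a)
    (hadj : ∀ (a : {x : V // part x = 0}) (x : V), x ≠ a → x ≠ σ a → (x < a ↔ x < σ a))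
    {U : Finset V} (hU : ∀ v, v ∈ U ↔ 2 ≤ part v) :
    ∃ i, ∃ z : Finset V → MvPolynomial V k,
      IsChain (i + 1)
        ((i + 1 + (∑ a : {x : V // part x = 0}, w a + ∑ v ∈ U, (w v - 1)) : ℕ) : ℤ) z ∧
      (∀ F, koszul k z F ∈ monIdeal k (edgeUpper σ w Finset.univ U)) ∧
      ¬ ∃ u, ∀ F, z F - koszul k u F ∈ monIdeal k (edgeUpper σ w Finset.univ U) := by
  set F₀ := transversal σ ∅ with hF₀
  set s := lowerExp (topExp σ w) F₀ with hs
  set z : Finset V → MvPolynomial V k := Pi.single F₀ (monomial s 1) with hz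
  have hzF {F : Finset V} {m : V →₀ ℕ} (h : coeff m (z F) ≠ 0) : F = F₀ ∧ m = s := by
    by_cases hF : F = F₀
    · subst hF
      rw [hz, Pi.single_eq_same, coeff_monomial] at h
      refine ⟨rfl, ?_⟩
      by_contra hm
      exact h (if_neg fun h' ↦ hm h'.symm)
    · simp [hz, hF] at h
  have hcard : 0 < F₀.card := by
    obtain ⟨a⟩ := ‹Nonempty {x : V // part x = 0}›
    exact Finset.card_pos.2
      ⟨a, (mem_transversal_of_part_eq_zero hσ a).2 (Finset.notMem_empty a)⟩
  have hUeq : U = Finset.univ.filter (2 ≤ part ·) := by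
    ext v
    simp [hU]
  have hdeg := degree_lowerExp hσinj hσ hw
  rw [← hUeq] at hdeg
  refine ⟨F₀.card - 1, z, ?_, ?_, ?_⟩
  · intro F m h
    obtain ⟨h1, h2⟩ := hzF h
    rw [h1, h2, hs, hF₀, hdeg, ← hF₀]
    refine ⟨by omega, ?_⟩
    push_cast
    ring
  · intro F m h
    obtain ⟨v, -, n, rfl, hn⟩ := exists_of_coeff_koszul_ne_zero h
    obtain ⟨h1, rfl⟩ := hzF hn
    exact single_add_lowerExp_mem hσinj hσ hw hlayer (fun v ↦ (hU v).2)
      (by rw [← hF₀, ← h1]; exact Finset.mem_insert_self v F)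
  · rintro ⟨u, hu⟩
    have h0 : cycleFunctional k σ w (z - koszul k u) = 0 := by
      refine Finset.sum_eq_zero fun A _ ↦ ?_
      by_contra h
      exact lowerExp_notMem_edgeUpper hσinj hσ hw (fun v ↦ (hU v).1) A (hu _ _ h)
    have h1 : cycleFunctional k σ w (z - koszul k u) =
        cycleFunctional k σ w z - cycleFunctional k σ w (koszul k u) := by
      simp [cycleFunctional]
    have h2 : cycleFunctional k σ w z = 1 := by
      unfold cycleFunctional
      rw [Finset.sum_eq_single ∅]
      · simp [hz, hs, hF₀]
      · intro A _ hA
        obtain ⟨a, ha⟩ := Finset.nonempty_iff_ne_empty.2 hA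
        by_contra h
        have h3 := (apply_mem_transversal hσinj hσ a).2 ha
        rw [(hzF h).1, hF₀, apply_mem_transversal hσinj hσ] at h3
        simp at h3
      · simp
    rw [h1, h2, cycleFunctional_koszul hσinj hσ hw hlt hadj] at h0
    simp at h0

end Functional

end LowerBound

end WOG

namespace WOG

section EdgeIdeal

variable {V k : Type} [Field k] [Fintype V]

/-- A linear order in which the endpoints of every matching edge are adjacent. -/
lemma exists_linearOrder_adjacent {part : V → ℕ} {σ : {x : V // part x = 0} → V}
    (hσinj : Function.Injective σ) (hσ : ∀ a, part (σ a) = 1) :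
    ∃ _ : LinearOrder V, (∀ a : {x : V // part x = 0}, (a : V) < σ a) ∧
      ∀ (a : {x : V // part x = 0}) (x : V), x ≠ a → x ≠ σ a → (x < a ↔ x < σ a) := by
  classical
  obtain ⟨e⟩ := Fintype.truncEquivFin V
  set key : V → ℕ := fun x ↦
    if h : x ∈ Set.range σ then 2 * (e h.choose : ℕ) + 1 else 2 * (e x : ℕ) with hkey
  have key_apply (a : {x : V // part x = 0}) : key (σ a) = 2 * (e a : ℕ) + 1 := by
    have h : σ a ∈ Set.range σ := ⟨a, rfl⟩
    have h2 : h.choose = a := hσinj h.choose_spec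
    simp only [hkey, dif_pos h, h2]
  have key_of_notMem {x : V} (h : x ∉ Set.range σ) : key x = 2 * (e x : ℕ) := by
    simp only [hkey, dif_neg h]
  have hne (a : {x : V // part x = 0}) : (a : V) ∉ Set.range σ := by
    rintro ⟨b, h⟩
    have h1 := hσ b
    rw [h, a.2] at h1
    omega
  have hinj : Function.Injective key := by
    intro x y hxy
    by_cases hx : x ∈ Set.range σ <;> by_cases hy : y ∈ Set.range σ
    · obtain ⟨a, rfl⟩ := hx
      obtain ⟨b, rfl⟩ := hy
      rw [key_apply, key_apply] at hxy
      rw [Subtype.ext (e.injective (Fin.ext (by omega : (e a : ℕ) = e b)))]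
    · obtain ⟨a, rfl⟩ := hx
      rw [key_apply, key_of_notMem hy] at hxy
      omega
    · obtain ⟨b, rfl⟩ := hy
      rw [key_apply, key_of_notMem hx] at hxy
      omega
    · rw [key_of_notMem hx, key_of_notMem hy] at hxy
      exact e.injective (Fin.ext (by omega))
  have hlt (a : {x : V // part x = 0}) : key (σ a) = key a + 1 := by
    rw [key_apply, key_of_notMem (hne a)]
  refine ⟨LinearOrder.lift' key hinj, fun a ↦ ?_, fun a x h1 h2 ↦ ?_⟩
  · change key a < key (σ a)
    rw [hlt]
    omega
  · change key x < key a ↔ key x < key (σ a)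
    have h3 : key x ≠ key a := fun h ↦ h1 (hinj h)
    rw [hlt]
    omega

omit [Fintype V] in
lemma edgeIdeal_le_mIdeal (E : Set (V × V)) (w : V → ℕ) : edgeIdeal k E w ≤ mIdeal k V := by
  refine Ideal.span_le.2 ?_
  rintro _ ⟨e, -, rfl⟩
  exact Ideal.mul_mem_right _ _ (Ideal.subset_span ⟨e.1, rfl⟩)

omit [Fintype V] in
lemma edgeIdeal_eq_monIdeal {part : V → ℕ} [Fintype {x : V // part x = 0}]
    {σ : {x : V // part x = 0} → V} (hσ : ∀ a, part (σ a) = 1) (w : V → ℕ) {U : Finset V}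
    (hU : ∀ v, v ∈ U ↔ 2 ≤ part v) :
    edgeIdeal k {p : V × V | (∃ a : {x : V // part x = 0}, p.1 = σ a ∧ p.2 = (a : V)) ∨
      (1 ≤ part p.1 ∧ part p.2 = part p.1 + 1)} w =
      monIdeal k (edgeUpper σ w Finset.univ U) := by
  set E := {p : V × V | (∃ a : {x : V // part x = 0}, p.1 = σ a ∧ p.2 = (a : V)) ∨
      (1 ≤ part p.1 ∧ part p.2 = part p.1 + 1)} with hE
  have hgen (e : V × V) : (X e.1 * X e.2 ^ w e.2 : MvPolynomial V k) =
      monomial (Finsupp.single e.1 1 + Finsupp.single e.2 (w e.2)) 1 := by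
    rw [X_pow_eq_monomial, X, monomial_mul, one_mul]
  have hne {e : V × V} (he : e ∈ E) : e.1 ≠ e.2 := by
    intro h
    rcases he with ⟨a, h1, h2⟩ | ⟨h1, h2⟩
    · have h3 := hσ a
      rw [← h1, h, h2, a.2] at h3
      omega
    · rw [h] at h2
      omega
  have hmem (m : V →₀ ℕ) : m ∈ edgeUpper σ w Finset.univ U ↔
      ∃ e ∈ E, Finsupp.single e.1 1 + Finsupp.single e.2 (w e.2) ≤ m := by
    rw [mem_edgeUpper]
    constructor
    · rintro (⟨a, -, h⟩ | ⟨v, -, u, h1, h2, h⟩)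
      · have he : (σ a, (a : V)) ∈ E := Or.inl ⟨a, rfl, rfl⟩
        exact ⟨_, he, (single_add_single_le_iff (hne he)).2 h⟩
      · have he : (u, v) ∈ E := Or.inr ⟨h1, h2⟩
        exact ⟨_, he, (single_add_single_le_iff (hne he)).2 h⟩
    · rintro ⟨⟨u, v⟩, he, h⟩
      rw [single_add_single_le_iff (hne he)] at h
      rcases he with ⟨a, rfl, rfl⟩ | ⟨h1, h2⟩
      · exact Or.inl ⟨a, Finset.mem_univ a, h⟩
      · dsimp only at h1 h2
        exact Or.inr ⟨v, (hU v).2 (by omega), u, h1, h2, h⟩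
  apply le_antisymm
  · refine Ideal.span_le.2 ?_
    rintro _ ⟨e, he, rfl⟩ m hm
    classical
    rw [hgen, coeff_monomial] at hm
    exact (hmem m).2 ⟨e, he, (ite_ne_right_iff.1 hm).1.le⟩
  · intro p hp
    rw [p.as_sum]
    refine Ideal.sum_mem _ fun m hm ↦ ?_
    obtain ⟨e, he, hle⟩ := (hmem m).1 (hp m (mem_support_iff.1 hm))
    have h := Ideal.mul_mem_left (edgeIdeal k E w)
      (monomial (m - (Finsupp.single e.1 1 + Finsupp.single e.2 (w e.2))) (coeff m p))
      (Ideal.subset_span ⟨e, he, rfl⟩)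
    rwa [hgen, monomial_mul, tsub_add_cancel_of_le hle, mul_one] at h

lemma isGreatest_regSet_of_regLE [LinearOrder V] {P : UpperSet (V →₀ ℕ)}
    {I : Ideal (MvPolynomial V k)} (hIP : I = monIdeal k P) (hI : I ≤ mIdeal k V)
    (R : MinFreeRes I) {r : ℕ} (hreg : RegLE k P r)
    (hcycle : ∃ i, ∃ z : Finset V → MvPolynomial V k, IsChain (i + 1) ((i + 1 + r : ℕ) : ℤ) z ∧
      (∀ F, koszul k z F ∈ monIdeal k P) ∧ ¬ ∃ u, ∀ F, z F - koszul k u F ∈ monIdeal k P) :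
    IsGreatest R.regSet ((r : ℤ) + 1) := by
  constructor
  · obtain ⟨i, z, hz, hzP, hu⟩ := hcycle
    refine ⟨i, i + 1 + r, fun h ↦ ?_, by push_cast; ring⟩
    rw [MinFreeRes.betti_eq_zero_iff_koszul R hI] at h
    obtain ⟨u, -, hu'⟩ := h z hz (hIP ▸ hzP)
    exact hu ⟨u, hIP ▸ hu'⟩
  · rintro _ ⟨i, j, hij, rfl⟩
    by_contra hlt
    refine hij ((MinFreeRes.betti_eq_zero_iff_koszul R hI i j).2 fun z hz hzI ↦ ?_)
    subst hIP
    exact hreg (i + 1) j z hz hzI (by push_cast; omega)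

lemma sum_weight_eq {part : V → ℕ} {w : V → ℕ} (hw : ∀ x, 1 ≤ w x)
    (h1 : ∀ x, part x = 1 → w x = 1) :
    ∑ x, w x = (∑ a : {x : V // part x = 0}, w a + ∑ v with 2 ≤ part v, (w v - 1)) +
      Nat.card {x : V // part x ≠ 0} := by
  rw [Nat.card_eq_fintype_card, Fintype.card_subtype, Finset.card_filter,
    ← Finset.sum_subtype (Finset.univ.filter (part · = 0)) (by simp) w, Finset.sum_filter,
    Finset.sum_filter, ← Finset.sum_add_distrib, ← Finset.sum_add_distrib]
  refine Finset.sum_congr rfl fun x _ ↦ ?_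
  have := hw x
  have := h1 x
  split_ifs <;> omega

end EdgeIdeal

end WOG

/-- **Theorem (second class, regularity).**
`D` is a vertex-weighted oriented `m`-partite graph (`m ≥ 2`) of the second
class: the vertex set is partitioned into nonempty parts `V_1, …, V_m`
(encoded by `part : V → Fin m`, with `|V_1| ≤ |V_2|`); `D_1` is a matching
pairing each vertex `a ∈ V_1` with a distinct vertex `σ a ∈ V_2`, its edges
directed from `V_2` to `V_1`; and for `2 ≤ i ≤ m-1` the edges between `V_i`
and `V_{i+1}` form a complete bipartite graph directed from `V_i` to
`V_{i+1}`.  `D` has no isolated vertices, sources have weight `1`, and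
non-source vertices outside `V_1 ⊔ V_m` have weight `≥ 2`.
Then `reg I(D) = (∑_{x ∈ V} w(x)) - |V \ V_1| + 1`. -/
theorem second_class_reg (k : Type) [Field k] (m : ℕ) (hm : 2 ≤ m)
    (V : Type) [Fintype V] (part : V → Fin m) (hpart : ∀ i : Fin m, ∃ x : V, part x = i)
    (ht : Nat.card {x : V // (part x : ℕ) = 0} ≤ Nat.card {x : V // (part x : ℕ) = 1})
    (σ : {x : V // (part x : ℕ) = 0} → V) (hσinj : Function.Injective σ)
    (hσ : ∀ a, (part (σ a) : ℕ) = 1)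
    (E : Set (V × V))
    (hE : E = {p : V × V |
      (∃ a : {x : V // (part x : ℕ) = 0}, p.1 = σ a ∧ p.2 = (a : V)) ∨
      (1 ≤ (part p.1 : ℕ) ∧ (part p.2 : ℕ) = (part p.1 : ℕ) + 1)})
    (hiso : ∀ x : V, ∃ y : V, (x, y) ∈ E ∨ (y, x) ∈ E)
    (w : V → ℕ) (hw : ∀ x : V, 1 ≤ w x)
    (hsrc : ∀ x : V, (∀ y : V, (y, x) ∉ E) → w x = 1)
    (hw2 : ∀ x : V, (∃ y : V, (y, x) ∈ E) →
      (part x : ℕ) ≠ 0 → (part x : ℕ) ≠ m - 1 → 2 ≤ w x)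
    (R : WOG.MinFreeRes (WOG.edgeIdeal k E w)) :
    IsGreatest R.regSet
      ((∑ x : V, (w x : ℤ)) - (Nat.card {x : V // (part x : ℕ) ≠ 0} : ℤ) + 1) := by
  have hlayer (v : V) (hv : 3 ≤ (part v : ℕ)) : ∃ u, (part u : ℕ) + 1 = part v ∧ 2 ≤ w u := by
    have hvm := (part v).isLt
    obtain ⟨u, hu⟩ := hpart ⟨part v - 1, by omega⟩
    obtain ⟨y, hy⟩ := hpart ⟨part v - 2, by omega⟩
    have hu' := congrArg Fin.val hu
    have hy' := congrArg Fin.val hy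
    dsimp only at hu' hy'
    refine ⟨u, by omega, hw2 u ⟨y, ?_⟩ (by omega) (by omega)⟩
    rw [hE]
    exact Or.inr ⟨by dsimp only; omega, by dsimp only; omega⟩
  have hone (x : V) (hx : (part x : ℕ) = 1) : w x = 1 := by
    refine hsrc x fun y hy ↦ ?_
    rw [hE] at hy
    rcases hy with ⟨a, -, h⟩ | ⟨h1, h2⟩
    · have := a.2
      dsimp only at h
      rw [← h] at this
      omega
    · dsimp only at h1 h2
      omega
  have : Nonempty {x : V // (part x : ℕ) = 0} := by
    obtain ⟨x, hx⟩ := hpart ⟨0, by omega⟩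
    exact ⟨⟨x, congrArg Fin.val hx⟩⟩
  obtain ⟨_, hlt, hadj⟩ := WOG.exists_linearOrder_adjacent (part := fun x ↦ (part x : ℕ)) hσinj hσ
  have hU (v : V) : v ∈ Finset.univ.filter (fun x ↦ 2 ≤ (part x : ℕ)) ↔ 2 ≤ (part v : ℕ) := by
    simp
  have hsum := WOG.sum_weight_eq (part := fun x ↦ (part x : ℕ)) hw hone
  have hr : (∑ x : V, (w x : ℤ)) - (Nat.card {x : V // (part x : ℕ) ≠ 0} : ℤ) + 1 =
      ((∑ a : {x : V // (part x : ℕ) = 0}, w a +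
        ∑ v with 2 ≤ (part v : ℕ), (w v - 1) : ℕ) : ℤ) + 1 := by
    rw [← Nat.cast_sum, hsum]
    push_cast
    ring
  rw [hr]
  refine WOG.isGreatest_regSet_of_regLE
    (hE ▸ WOG.edgeIdeal_eq_monIdeal (part := fun x ↦ (part x : ℕ)) hσ w hU)
    (WOG.edgeIdeal_le_mIdeal E w) R ?_ ?_
  · exact WOG.regLE_edgeUpper hσinj hσ hw hlayer _ (fun v hv ↦ (hU v).1 hv)
      fun v _ u hu _ ↦ (hU u).2 hu
  · exact WOG.exists_extremal_cycle hσinj hσ hw hlayer hlt hadj hU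
end
end

section
/- Let m ≥ 2 be an integer and let D = (V,E,w) be a vertex-weighted oriented m-partite graph of the second class (with m parts), having no isolated vertices. Assume w(x) = 1 for every source vertex of D and w(x) ≥ 2 for every non-source vertex x ∈ V \ (V_1 ⊔ V_m). Then the projective dimension of the edge ideal satisfies pd(I(D)) = |V \ V_1| − 2 if |V_1| < |V_2|, and pd(I(D)) = |V \ V_2| − 1 if |V_1| = |V_2|. -/
open MvPolynomial

noncomputable section

section

open MvPolynomial CategoryTheory Abelian

section Homological

variable {R : Type} [CommRing R]

theorem shortExact_of_linearMap {A B C : Type} [AddCommGroup A] [Module R A]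
    [AddCommGroup B] [Module R B] [AddCommGroup C] [Module R C] (f : A →ₗ[R] B) (g : B →ₗ[R] C)
    (hf : Function.Injective f) (hg : Function.Surjective g) (hfg : Function.Exact f g) :
    (ModuleCat.shortComplexOfCompEqZero f g hfg.linearMap_comp_eq_zero).ShortExact where
  exact := ModuleCat.shortComplex_exact _ hfg
  mono_f := (ModuleCat.mono_iff_injective _).2 hf
  epi_g := (ModuleCat.epi_iff_surjective _).2 hg

/-- The quotient by the ideal `I` has projective dimension at most `n`. -/
abbrev PdQuotLE (I : Ideal R) (n : ℕ) : Prop :=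
  HasProjectiveDimensionLE (ModuleCat.of R (R ⧸ I)) n

theorem PdQuotLE.mono {I : Ideal R} {m n : ℕ} (h : PdQuotLE I m) (hmn : m ≤ n) : PdQuotLE I n := by
  have : HasProjectiveDimensionLT (ModuleCat.of R (R ⧸ I)) (m + 1) := h
  exact hasProjectiveDimensionLT_of_ge _ (m + 1) (n + 1) (by lia)

theorem pdQuotLE_bot : PdQuotLE (⊥ : Ideal R) 0 := by
  have : Module.Projective R (R ⧸ (⊥ : Ideal R)) :=
    Module.Projective.of_equiv (Submodule.quotEquivOfEqBot (⊥ : Ideal R) rfl).symm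
  have : Projective (ModuleCat.of R (R ⧸ (⊥ : Ideal R))) :=
    (IsProjective.iff_projective _).1 this
  exact projective_iff_hasProjectiveDimensionLT_one.1 this

/-- The short exact sequence `0 → R/J → R/I → R/K → 0` whose first map is multiplication by `f`,
where `J = (I : f)` and `K = I + (f)`. -/
theorem exists_shortExact_colon {I J K : Ideal R} {f : R}
    (hJ : ∀ r, r ∈ J ↔ f * r ∈ I) (hK : ∀ r, r ∈ K ↔ ∃ s, r - f * s ∈ I) :
    ∃ (a : (R ⧸ J) →ₗ[R] (R ⧸ I)) (b : (R ⧸ I) →ₗ[R] (R ⧸ K)),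
      Function.Injective a ∧ Function.Surjective b ∧ Function.Exact a b := by
  have hJI : J ≤ Submodule.comap (LinearMap.mulLeft R f) I := fun r hr => (hJ r).1 hr
  have hIK : I ≤ K := fun r hr => (hK r).2 ⟨0, by simpa using hr⟩
  refine ⟨Submodule.mapQ J I (LinearMap.mulLeft R f) hJI, Submodule.factor hIK, ?_,
    Submodule.factor_surjective hIK, ?_⟩
  · rw [← LinearMap.ker_eq_bot, LinearMap.ker_eq_bot']
    intro x
    obtain ⟨r, rfl⟩ := Submodule.Quotient.mk_surjective _ x
    intro h
    rw [Submodule.mapQ_apply, Submodule.Quotient.mk_eq_zero] at h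
    exact (Submodule.Quotient.mk_eq_zero _).2 ((hJ r).2 h)
  · intro x
    obtain ⟨r, rfl⟩ := Submodule.Quotient.mk_surjective _ x
    rw [← Submodule.mkQ_apply, Submodule.factor_mk, Submodule.mkQ_apply,
      Submodule.Quotient.mk_eq_zero, hK]
    constructor
    · rintro ⟨s, hs⟩
      refine ⟨Submodule.Quotient.mk s, ?_⟩
      rw [Submodule.mapQ_apply, eq_comm]
      exact (Submodule.Quotient.eq _).2 hs
    · rintro ⟨y, hy⟩
      obtain ⟨s, rfl⟩ := Submodule.Quotient.mk_surjective _ y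
      rw [Submodule.mapQ_apply, eq_comm] at hy
      exact ⟨s, (Submodule.Quotient.eq _).1 hy⟩

theorem PdQuotLE.of_colon {I J K : Ideal R} {f : R} {n : ℕ}
    (hJ : ∀ r, r ∈ J ↔ f * r ∈ I) (hK : ∀ r, r ∈ K ↔ ∃ s, r - f * s ∈ I)
    (pJ : PdQuotLE J n) (pK : PdQuotLE K n) : PdQuotLE I n := by
  obtain ⟨a, b, ha, hb, hab⟩ := exists_shortExact_colon hJ hK
  exact (shortExact_of_linearMap a b ha hb hab).hasProjectiveDimensionLT_X₂ (n + 1) pJ pK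

theorem PdQuotLE.add_regular {I K : Ideal R} {f : R} {n : ℕ}
    (hI : ∀ r, r ∈ I ↔ f * r ∈ I) (hK : ∀ r, r ∈ K ↔ ∃ s, r - f * s ∈ I)
    (pI : PdQuotLE I n) : PdQuotLE K (n + 1) := by
  obtain ⟨a, b, ha, hb, hab⟩ := exists_shortExact_colon hI hK
  exact (shortExact_of_linearMap a b ha hb hab).hasProjectiveDimensionLT_X₃ (n + 1) pI
    (pI.mono n.le_succ)

theorem PdQuotLE.inf {I J : Ideal R} {n : ℕ} (hI : PdQuotLE I n) (hJ : PdQuotLE J n)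
    (hIJ : PdQuotLE (I ⊔ J) (n + 1)) : PdQuotLE (I ⊓ J) n := by
  have hprod : HasProjectiveDimensionLT (ModuleCat.of R ((R ⧸ I) × (R ⧸ J))) (n + 1) :=
    (shortExact_of_linearMap (LinearMap.inl R (R ⧸ I) (R ⧸ J)) (LinearMap.snd R (R ⧸ I) (R ⧸ J))
      LinearMap.inl_injective LinearMap.snd_surjective
      Function.Exact.inl_snd).hasProjectiveDimensionLT_X₂ (n + 1) hI hJ
  let a : (R ⧸ I ⊓ J) →ₗ[R] (R ⧸ I) × (R ⧸ J) :=
    (Submodule.factor inf_le_left).prod (Submodule.factor inf_le_right)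
  let b : (R ⧸ I) × (R ⧸ J) →ₗ[R] (R ⧸ I ⊔ J) :=
    (Submodule.factor le_sup_left).coprod (-Submodule.factor le_sup_right)
  have ha_mk (r : R) :
      a (Submodule.Quotient.mk r) = (Submodule.Quotient.mk r, Submodule.Quotient.mk r) := rfl
  have hb_mk (r s : R) : b (Submodule.Quotient.mk r, Submodule.Quotient.mk s) =
      Submodule.Quotient.mk (r - s) := by
    simp [b, sub_eq_add_neg]
  have ha : Function.Injective a := by
    rw [← LinearMap.ker_eq_bot, LinearMap.ker_eq_bot']
    intro x
    obtain ⟨r, rfl⟩ := Submodule.Quotient.mk_surjective _ x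
    intro h
    rw [ha_mk, Prod.mk_eq_zero, Submodule.Quotient.mk_eq_zero, Submodule.Quotient.mk_eq_zero] at h
    exact (Submodule.Quotient.mk_eq_zero _).2 h
  have hb : Function.Surjective b := by
    intro x
    obtain ⟨r, rfl⟩ := Submodule.Quotient.mk_surjective _ x
    exact ⟨(Submodule.Quotient.mk r, Submodule.Quotient.mk 0), by rw [hb_mk, sub_zero]⟩
  have hab : Function.Exact a b := by
    rintro ⟨x, y⟩
    obtain ⟨r, rfl⟩ := Submodule.Quotient.mk_surjective _ x
    obtain ⟨s, rfl⟩ := Submodule.Quotient.mk_surjective _ y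
    rw [hb_mk, Submodule.Quotient.mk_eq_zero]
    constructor
    · intro h
      obtain ⟨i, hi, j, hj, hij⟩ := Submodule.mem_sup.1 h
      refine ⟨Submodule.Quotient.mk (r - i), ?_⟩
      rw [ha_mk, Prod.mk_inj, Submodule.Quotient.eq, Submodule.Quotient.eq]
      refine ⟨by simpa using hi, ?_⟩
      have : r - i - s = j := by linear_combination -hij
      rwa [this]
    · rintro ⟨z, hz⟩
      obtain ⟨t, rfl⟩ := Submodule.Quotient.mk_surjective _ z
      rw [ha_mk, Prod.mk_inj, Submodule.Quotient.eq, Submodule.Quotient.eq] at hz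
      have : r - s = -(t - r) + (t - s) := by ring
      rw [this]
      exact add_mem (neg_mem (Ideal.mem_sup_left hz.1)) (Ideal.mem_sup_right hz.2)
  exact (shortExact_of_linearMap a b ha hb hab).hasProjectiveDimensionLT_X₁ (n + 1) hprod hIJ

/-- Vanishing of `Ext` below the length of a weakly regular sequence annihilating the source. -/
theorem subsingleton_ext_of_isWeaklyRegular (N : ModuleCat.{0} R) (rs : List R)
    (M : ModuleCat.{0} R) (hN : ∀ r ∈ rs, r ∈ Module.annihilator R N)
    (reg : RingTheory.Sequence.IsWeaklyRegular M rs) :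
    ∀ i < rs.length, Subsingleton (Ext N M i) := by
  induction rs generalizing M with
  | nil => simp
  | cons a rs ih =>
    rw [RingTheory.Sequence.isWeaklyRegular_cons_iff] at reg
    have ha := hN a List.mem_cons_self
    rintro (_ | i) hi
    · have : Subsingleton (N →ₗ[R] M) := ⟨fun f g => LinearMap.ext fun x => reg.1 (by
        change a • f x = a • g x
        rw [← map_smul, ← map_smul, Module.mem_annihilator.1 ha, map_zero, map_zero])⟩
      exact (Ext.addEquiv₀.trans ModuleCat.homAddEquiv).subsingleton
    · let g := AddCommGrpCat.ofHom ((Ext.mk₀ (ModuleCat.smulShortComplex M a).f).postcomp N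
          (add_zero (i + 1)))
      have mono_g : Mono g := by
        refine (Ext.covariant_sequence_exact₁' N reg.1.smulShortComplex_shortExact i (i + 1)
          rfl).mono_g ((AddCommGrpCat.isZero_of_iff_subsingleton.mpr ?_).eq_zero_of_src _)
        exact ih (ModuleCat.of R (QuotSMulTop a M))
          (fun r hr => hN r (List.mem_cons_of_mem _ hr)) reg.2 i (by simpa using hi)
      have zero_g : g = 0 := Ext.postcomp_smul_id_eq_zero_of_mem_annihilator ha (i + 1)
      exact AddCommGrpCat.subsingleton_of_isZero (Limits.IsZero.of_mono_eq_zero _ zero_g)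

theorem subsingleton_ext_X₃ {S : ShortComplex (ModuleCat.{0} R)} (hS : S.ShortExact)
    (N : ModuleCat.{0} R) (i : ℕ) (h₂ : Subsingleton (Ext N S.X₂ i))
    (h₁ : Subsingleton (Ext N S.X₁ (i + 1))) : Subsingleton (Ext N S.X₃ i) := by
  refine subsingleton_of_forall_eq 0 fun x => ?_
  obtain ⟨y, rfl⟩ := Ext.covariant_sequence_exact₃ N hS x rfl (Subsingleton.elim _ _)
  rw [Subsingleton.elim y 0, Ext.zero_comp]

end Homological

section Resolution

variable {k V : Type} [Field k] {I : Ideal (MvPolynomial V k)}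

theorem exists_shortExact_of_range_eq {R F M : Type} [CommRing R] [AddCommGroup F] [Module R F]
    [AddCommGroup M] [Module R M] (φ : F →ₗ[R] M) (K : Submodule R M)
    (h : LinearMap.range φ = K) :
    ∃ (f : ModuleCat.of R (LinearMap.ker φ) ⟶ ModuleCat.of R F)
      (g : ModuleCat.of R F ⟶ ModuleCat.of R K) (w : f ≫ g = 0),
      (ShortComplex.mk f g w).ShortExact := by
  have hφ (x : F) : φ x ∈ K := h ▸ LinearMap.mem_range_self φ x
  have hex : Function.Exact (LinearMap.ker φ).subtype (φ.codRestrict K hφ) := by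
    intro x
    simp [Subtype.ext_iff]
  refine ⟨_, _, _, shortExact_of_linearMap (LinearMap.ker φ).subtype (φ.codRestrict K hφ)
    (Submodule.injective_subtype _) ?_ hex⟩
  rintro ⟨y, hy⟩
  obtain ⟨x, rfl⟩ := h.symm ▸ hy
  exact ⟨x, rfl⟩

/-- A map from a finite free module over a domain whose image is projective is injective, provided
its kernel consists of vectors with entries in a proper ideal. -/
theorem ker_eq_bot_of_projective_range {R ι M : Type} [CommRing R] [IsDomain R]
    [IsNoetherianRing R] [Finite ι] [AddCommGroup M] [Module R M] (φ : (ι →₀ R) →ₗ[R] M)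
    (K : Submodule R M) (hK : LinearMap.range φ = K) [Module.Projective R K] {m : Ideal R}
    (hm : m ≠ ⊤) (hker : ∀ x ∈ LinearMap.ker φ, ∀ b, x b ∈ m) : LinearMap.ker φ = ⊥ := by
  classical
  have := Fintype.ofFinite ι
  subst hK
  obtain ⟨s, hs⟩ := Module.projective_lifting_property φ.rangeRestrict LinearMap.id
    φ.surjective_rangeRestrict
  have hφs (y : LinearMap.range φ) : φ (s y) = y :=
    congrArg Subtype.val (LinearMap.congr_fun hs y)
  let π : (ι →₀ R) →ₗ[R] (ι →₀ R) := LinearMap.id - s ∘ₗ φ.rangeRestrict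
  have hπ (x) : π x ∈ LinearMap.ker φ := by
    simp [π, hφs]
  have hπ_ker (x) (hx : x ∈ LinearMap.ker φ) : π x = x := by
    have : φ.rangeRestrict x = 0 := Subtype.ext hx
    simp [π, this]
  have hle : LinearMap.ker φ ≤ m • LinearMap.ker φ := by
    intro x hx
    rw [← hπ_ker x hx, ← Finsupp.univ_sum_single x, map_sum]
    refine Submodule.sum_mem _ fun b _ => ?_
    rw [← mul_one (x b), ← smul_eq_mul, ← Finsupp.smul_single, map_smul]
    exact Submodule.smul_mem_smul (hker x hx b) (hπ _)
  obtain ⟨r, hr, hr0⟩ := Submodule.exists_sub_one_mem_and_smul_eq_zero_of_fg_of_le_smul m _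
    (IsNoetherian.noetherian (LinearMap.ker φ)) hle
  have hrne : r ≠ 0 := by
    rintro rfl
    exact hm ((Ideal.eq_top_iff_one m).2 (by simpa using neg_mem hr))
  rw [eq_bot_iff]
  intro x hx
  exact (smul_eq_zero.1 (hr0 x hx)).resolve_left hrne

theorem WOG.mIdeal_ne_top : WOG.mIdeal k V ≠ ⊤ := by
  rw [Ideal.ne_top_iff_one, WOG.mIdeal, ← Set.image_univ, mem_ideal_span_X_image]
  intro h
  obtain ⟨i, -, hi⟩ := h 0 (by simp)
  exact hi rfl

namespace WOG.MinFreeRes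

variable (R : MinFreeRes I)

/-- The syzygy modules of a resolution; the `0`-th one is the resolved ideal. -/
def syzygy : ℕ → ModuleCat.{0} (MvPolynomial V k)
  | 0 => ModuleCat.of _ I
  | 1 => ModuleCat.of _ (LinearMap.ker R.aug)
  | i + 2 => ModuleCat.of _ (LinearMap.ker (R.d i))

theorem exists_shortExact_syzygy (i : ℕ) :
    ∃ (f : R.syzygy (i + 1) ⟶ ModuleCat.of _ (R.ι i →₀ MvPolynomial V k))
      (g : ModuleCat.of _ (R.ι i →₀ MvPolynomial V k) ⟶ R.syzygy i) (w : f ≫ g = 0),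
      (ShortComplex.mk f g w).ShortExact :=
  match i with
  | 0 => exists_shortExact_of_range_eq R.aug I R.aug_range
  | 1 => exists_shortExact_of_range_eq (R.d 0) (LinearMap.ker R.aug) R.exact_zero
  | i + 2 => exists_shortExact_of_range_eq (R.d (i + 1)) (LinearMap.ker (R.d i)) (R.exact_succ i)

theorem d_apply_mem (i : ℕ) (x : R.ι (i + 1) →₀ MvPolynomial V k) (b : R.ι i) :
    R.d i x b ∈ mIdeal k V := by
  induction x using Finsupp.induction_linear with
  | zero => simp
  | add f g hf hg => simpa using add_mem hf hg
  | single a c =>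
    rw [← mul_one c, ← smul_eq_mul, ← Finsupp.smul_single, map_smul]
    exact Ideal.mul_mem_left _ _ (R.minimal i a b)

theorem d_eq_zero_of_projective_syzygy [Finite V] (i : ℕ) (h : Projective (R.syzygy i)) :
    R.d i = 0 := by
  have := R.finite i
  rw [← LinearMap.range_eq_bot]
  cases i with
  | zero =>
    have : Module.Projective (MvPolynomial V k) I := (IsProjective.iff_projective _).2 h
    rw [R.exact_zero]
    refine ker_eq_bot_of_projective_range R.aug I R.aug_range (mIdeal_ne_top (k := k) (V := V)) ?_
    rw [← R.exact_zero]
    rintro _ ⟨y, rfl⟩ b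
    exact R.d_apply_mem 0 y b
  | succ i =>
    rw [R.exact_succ]
    have key (K : Submodule (MvPolynomial V k) (R.ι i →₀ MvPolynomial V k))
        (hK : LinearMap.range (R.d i) = K) (hp : Module.Projective (MvPolynomial V k) K) :
        LinearMap.ker (R.d i) = ⊥ := by
      refine ker_eq_bot_of_projective_range (R.d i) K hK (mIdeal_ne_top (k := k) (V := V)) ?_
      rw [← R.exact_succ]
      rintro _ ⟨y, rfl⟩ b
      exact R.d_apply_mem (i + 1) y b
    cases i with
    | zero => exact key _ R.exact_zero ((IsProjective.iff_projective _).2 h)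
    | succ i => exact key _ (R.exact_succ i) ((IsProjective.iff_projective _).2 h)

theorem isEmpty_of_projective_syzygy [Finite V] (i : ℕ) (h : Projective (R.syzygy i)) :
    IsEmpty (R.ι (i + 1)) := by
  refine ⟨fun a => ?_⟩
  have hd := R.d_eq_zero_of_projective_syzygy i h
  have ha : Finsupp.single a 1 ∈ LinearMap.range (R.d (i + 1)) := by
    rw [R.exact_succ, hd, LinearMap.ker_zero]
    trivial
  obtain ⟨x, hx⟩ := ha
  have h1 := R.d_apply_mem (i + 1) x a
  rw [hx, Finsupp.single_eq_same] at h1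
  exact mIdeal_ne_top ((Ideal.eq_top_iff_one _).2 h1)

instance (ι : Type) : Projective (ModuleCat.of (MvPolynomial V k) (ι →₀ MvPolynomial V k)) :=
  (IsProjective.iff_projective _).1 inferInstance

theorem hasProjectiveDimensionLT_syzygy (n i : ℕ)
    (h : HasProjectiveDimensionLT (R.syzygy 0) (n + 1 + i)) :
    HasProjectiveDimensionLT (R.syzygy i) (n + 1) := by
  induction i generalizing n with
  | zero => exact h
  | succ i ih =>
    obtain ⟨f, g, w, hS⟩ := R.exists_shortExact_syzygy i
    refine (hS.hasProjectiveDimensionLT_X₃_iff n inferInstance).1 (ih (n + 1) ?_)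
    rwa [show n + 1 + 1 + i = n + 1 + (i + 1) by lia]

theorem exists_shortExact_ideal (I : Ideal (MvPolynomial V k)) :
    ∃ (f : ModuleCat.of (MvPolynomial V k) I ⟶ ModuleCat.of _ (MvPolynomial V k))
      (g : ModuleCat.of _ (MvPolynomial V k) ⟶ ModuleCat.of _ (MvPolynomial V k ⧸ I))
      (w : f ≫ g = 0), (ShortComplex.mk f g w).ShortExact :=
  ⟨_, _, _, shortExact_of_linearMap (Submodule.subtype I) (Submodule.mkQ I)
    (Submodule.injective_subtype _) (Submodule.mkQ_surjective _)
    (LinearMap.exact_subtype_mkQ I)⟩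

/-- A minimal resolution of an ideal is no longer than the projective dimension allows. -/
theorem isEmpty_of_pdQuotLE [Finite V] {n i : ℕ} (h : PdQuotLE I (n + 1)) (hi : n < i) :
    IsEmpty (R.ι i) := by
  obtain ⟨i, rfl⟩ : ∃ j, i = j + 1 := ⟨i - 1, by lia⟩
  obtain ⟨f, g, w, hS⟩ := exists_shortExact_ideal I
  have : Projective (ModuleCat.of (MvPolynomial V k) (MvPolynomial V k)) :=
    (IsProjective.iff_projective _).1 inferInstance
  have h0 : HasProjectiveDimensionLT (R.syzygy 0) (n + 1) :=
    (hS.hasProjectiveDimensionLT_X₃_iff n this).1 h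
  have hi0 : HasProjectiveDimensionLT (R.syzygy 0) (0 + 1 + i) :=
    hasProjectiveDimensionLT_of_ge _ (n + 1) _ (by lia)
  have := R.hasProjectiveDimensionLT_syzygy 0 i hi0
  exact R.isEmpty_of_projective_syzygy i (projective_iff_hasProjectiveDimensionLT_one.2 this)

/-- If the resolution vanishes in degree `p`, then `Ext` groups into the ideal vanish
in a range controlled by the grade of the source. -/
theorem subsingleton_ext_ideal_quotient (N : ModuleCat.{0} (MvPolynomial V k)) {n p : ℕ}
    (hp : IsEmpty (R.ι p))
    (hfree : ∀ (ι : Type), ∀ i < n, Subsingleton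
      (Ext N (ModuleCat.of _ (ι →₀ MvPolynomial V k)) i))
    {j : ℕ} (hj : j + 1 + p ≤ n) :
    Subsingleton (Ext N (ModuleCat.of _ (MvPolynomial V k ⧸ I)) j) := by
  have hsyz : ∀ a b j, a + b = p → j + a ≤ n → Subsingleton (Ext N (R.syzygy b) j) := by
    intro a
    induction a with
    | zero =>
      rintro b j rfl hja
      obtain ⟨f, g, w, hS⟩ := R.exists_shortExact_syzygy (0 + b)
      have hz : Limits.IsZero (R.syzygy (0 + b)) := by
        have : Subsingleton (R.syzygy (0 + b)) := hS.moduleCat_surjective_g.subsingleton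
        exact ModuleCat.isZero_of_subsingleton _
      rw [zero_add] at hz
      refine subsingleton_of_forall_eq 0 fun x => ?_
      rw [← x.comp_mk₀_id, hz.eq_of_src (𝟙 _) 0, Ext.mk₀_zero, Ext.comp_zero]
    | succ a ih =>
      intro b j hab hja
      obtain ⟨f, g, w, hS⟩ := R.exists_shortExact_syzygy b
      exact subsingleton_ext_X₃ hS N j (hfree _ j (by lia)) (ih (b + 1) (j + 1) (by lia) (by lia))
  obtain ⟨f, g, w, hS⟩ := exists_shortExact_ideal I
  refine subsingleton_ext_X₃ hS N j ?_ (hsyz p 0 (j + 1) (by lia) (by lia))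
  have := hfree Unit j (by lia)
  let e : ModuleCat.of (MvPolynomial V k) (Unit →₀ MvPolynomial V k) ≅
      ModuleCat.of _ (MvPolynomial V k) := (Finsupp.uniqueLinearEquiv _ _ ()).toModuleIso
  refine subsingleton_of_forall_eq 0 fun x => ?_
  have hx : x.comp (Ext.mk₀ e.inv) (add_zero j) = 0 := Subsingleton.elim _ _
  rw [← x.comp_mk₀_id, ← e.inv_hom_id, ← Ext.mk₀_comp_mk₀, ← Ext.comp_assoc_of_third_deg_zero, hx,
    Ext.zero_comp]

theorem mem_pdSet_iff {i : ℕ} : i ∈ R.pdSet ↔ Nonempty (R.ι i) := by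
  have := R.finite i
  constructor
  · rintro ⟨j, hj⟩
    obtain ⟨⟨a, -⟩⟩ := (Nat.card_ne_zero.1 hj).1
    exact ⟨a⟩
  · rintro ⟨a⟩
    exact ⟨R.deg i a, Nat.card_ne_zero.2 ⟨⟨⟨a, rfl⟩⟩, inferInstance⟩⟩

end WOG.MinFreeRes

end Resolution

section MonomialIdeal

variable {k V : Type} [Field k] {U U' : Set (V →₀ ℕ)} {n : ℕ}

theorem mem_restrictSupportIdeal_iff (hU : IsUpperSet U) {p : MvPolynomial V k} :
    p ∈ restrictSupportIdeal k U hU ↔ ∀ α, coeff α p ≠ 0 → α ∈ U := by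
  change p ∈ restrictSupport k U ↔ _
  rw [mem_restrictSupport_iff]
  exact forall_congr' fun α => by rw [Finset.mem_coe, mem_support_iff]

variable (k) in
/-- `U` is an upper set of exponents, and the quotient by the monomial ideal spanned by the
monomials with exponent in `U` has projective dimension at most `n`. -/
def MonomialPdLE (U : Set (V →₀ ℕ)) (n : ℕ) : Prop :=
  ∃ hU : IsUpperSet U, PdQuotLE (restrictSupportIdeal k U hU) n

theorem MonomialPdLE.mono {m : ℕ} (h : MonomialPdLE k U m) (hmn : m ≤ n) : MonomialPdLE k U n :=
  ⟨h.1, h.2.mono hmn⟩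

theorem monomialPdLE_empty : MonomialPdLE k (∅ : Set (V →₀ ℕ)) 0 := by
  refine ⟨isUpperSet_empty, ?_⟩
  convert pdQuotLE_bot (R := MvPolynomial V k)
  ext p
  rw [mem_restrictSupportIdeal_iff, Ideal.mem_bot, MvPolynomial.ext_iff]
  simp

theorem monomialPdLE_univ : MonomialPdLE k (Set.univ : Set (V →₀ ℕ)) 0 := by
  refine ⟨isUpperSet_univ, ?_⟩
  have h : restrictSupportIdeal k (Set.univ : Set (V →₀ ℕ)) isUpperSet_univ = ⊤ := by
    ext p
    simp [mem_restrictSupportIdeal_iff]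
  have : Subsingleton (MvPolynomial V k ⧸
      restrictSupportIdeal k (Set.univ : Set (V →₀ ℕ)) isUpperSet_univ) :=
    Ideal.Quotient.subsingleton_iff.2 h
  have : Projective (ModuleCat.of (MvPolynomial V k) (MvPolynomial V k ⧸
      restrictSupportIdeal k (Set.univ : Set (V →₀ ℕ)) isUpperSet_univ)) :=
    (IsProjective.iff_projective _).1 inferInstance
  exact projective_iff_hasProjectiveDimensionLT_one.1 this

theorem monomial_mul_mem_restrictSupportIdeal_iff (hU : IsUpperSet U) (f : V →₀ ℕ)
    {p : MvPolynomial V k} :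
    monomial f 1 * p ∈ restrictSupportIdeal k U hU ↔ ∀ α, coeff α p ≠ 0 → f + α ∈ U := by
  rw [mem_restrictSupportIdeal_iff]
  constructor
  · intro h α hα
    exact h _ (by rwa [coeff_monomial_mul, one_mul])
  · intro h α hα
    rw [coeff_monomial_mul'] at hα
    split_ifs at hα with hf
    · rw [one_mul] at hα
      simpa [add_tsub_cancel_of_le hf] using h _ hα
    · exact absurd rfl hα

theorem mem_restrictSupportIdeal_or_le_iff (hU : IsUpperSet U) (f : V →₀ ℕ)
    (hU' : IsUpperSet {α | α ∈ U ∨ f ≤ α}) {p : MvPolynomial V k} :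
    p ∈ restrictSupportIdeal k {α | α ∈ U ∨ f ≤ α} hU' ↔
      ∃ q, p - monomial f 1 * q ∈ restrictSupportIdeal k U hU := by
  simp only [mem_restrictSupportIdeal_iff]
  constructor
  · intro h
    refine ⟨p.divMonomial f, fun α hα => ?_⟩
    have hmod : p - monomial f 1 * p.divMonomial f = p.modMonomial f := by
      rw [sub_eq_iff_eq_add', divMonomial_add_modMonomial]
    rw [hmod] at hα
    by_cases hf : f ≤ α
    · exact absurd (coeff_modMonomial_of_le p hf) hα
    · rw [coeff_modMonomial_of_not_le p hf] at hα
      exact (h α hα).resolve_right hf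
  · rintro ⟨q, hq⟩ α hα
    by_cases hf : f ≤ α
    · exact Or.inr hf
    · refine Or.inl (hq α ?_)
      rwa [coeff_sub, coeff_monomial_mul', if_neg hf, sub_zero]

theorem MonomialPdLE.of_colon (hU : IsUpperSet U) (f : V →₀ ℕ)
    (h₁ : MonomialPdLE k {α | f + α ∈ U} n) (h₂ : MonomialPdLE k {α | α ∈ U ∨ f ≤ α} n) :
    MonomialPdLE k U n := by
  obtain ⟨hU₁, h₁⟩ := h₁
  obtain ⟨hU₂, h₂⟩ := h₂
  refine ⟨hU, PdQuotLE.of_colon (f := monomial f 1) (fun p => ?_)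
    (fun p => mem_restrictSupportIdeal_or_le_iff hU f hU₂) h₁ h₂⟩
  rw [mem_restrictSupportIdeal_iff, monomial_mul_mem_restrictSupportIdeal_iff]
  rfl

theorem MonomialPdLE.add_regular (h : MonomialPdLE k U n) (f : V →₀ ℕ)
    (hf : ∀ α, f + α ∈ U → α ∈ U) : MonomialPdLE k {α | α ∈ U ∨ f ≤ α} (n + 1) := by
  obtain ⟨hU, h⟩ := h
  have hU' : IsUpperSet {α | α ∈ U ∨ f ≤ α} := hU.union (isUpperSet_Ici f)
  refine ⟨hU', PdQuotLE.add_regular (f := monomial f 1) (fun p => ?_)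
    (fun p => mem_restrictSupportIdeal_or_le_iff hU f hU') h⟩
  rw [mem_restrictSupportIdeal_iff, monomial_mul_mem_restrictSupportIdeal_iff]
  exact forall₂_congr fun α _ => ⟨hU (le_add_of_nonneg_left zero_le), hf α⟩

theorem MonomialPdLE.inter (h : MonomialPdLE k U n) (h' : MonomialPdLE k U' n)
    (hU : MonomialPdLE k (U ∪ U') (n + 1)) : MonomialPdLE k (U ∩ U') n := by
  classical
  obtain ⟨hu, h⟩ := h
  obtain ⟨hu', h'⟩ := h'
  obtain ⟨hU, H⟩ := hU
  refine ⟨hu.inter hu', ?_⟩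
  have hinf : restrictSupportIdeal k (U ∩ U') (hu.inter hu') =
      restrictSupportIdeal k U hu ⊓ restrictSupportIdeal k U' hu' := by
    ext p
    simp only [Ideal.mem_inf, mem_restrictSupportIdeal_iff]
    exact ⟨fun H => ⟨fun α hα => (H α hα).1, fun α hα => (H α hα).2⟩,
      fun H α hα => ⟨H.1 α hα, H.2 α hα⟩⟩
  have hsup : restrictSupportIdeal k (U ∪ U') hU =
      restrictSupportIdeal k U hu ⊔ restrictSupportIdeal k U' hu' := by
    apply le_antisymm
    · intro p hp
      rw [mem_restrictSupportIdeal_iff] at hp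
      rw [p.as_sum]
      refine sum_mem fun α hα => ?_
      have hmem {W : Set (V →₀ ℕ)} (hW : IsUpperSet W) (hαW : α ∈ W) :
          monomial α (coeff α p) ∈ restrictSupportIdeal k W hW := by
        rw [mem_restrictSupportIdeal_iff]
        intro β hβ
        rw [coeff_monomial] at hβ
        rwa [← (ite_ne_right_iff.1 hβ).1]
      rcases hp α (mem_support_iff.1 hα) with hα | hα
      · exact Ideal.mem_sup_left (hmem hu hα)
      · exact Ideal.mem_sup_right (hmem hu' hα)
    · refine sup_le (fun p hp => ?_) (fun p hp => ?_) <;> rw [mem_restrictSupportIdeal_iff] at hp ⊢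
      · exact fun α hα => Or.inl (hp α hα)
      · exact fun α hα => Or.inr (hp α hα)
  rw [hinf]
  exact PdQuotLE.inf h h' (hsup ▸ H)

theorem MonomialPdLE.add_regular_finset {ι : Type} (h : MonomialPdLE k U n) (T : Finset ι)
    (f : ι → V →₀ ℕ) (hf : ∀ i ∈ T, ∀ α, f i + α ∈ U → α ∈ U)
    (hdisj : ∀ i ∈ T, ∀ j ∈ T, i ≠ j → ∀ v, f i v = 0 ∨ f j v = 0) :
    MonomialPdLE k {α | α ∈ U ∨ ∃ i ∈ T, f i ≤ α} (n + T.card) := by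
  classical
  induction T using Finset.induction_on with
  | empty => simpa using h
  | insert j T hj ih =>
    rw [Finset.card_insert_of_notMem hj, ← add_assoc]
    convert MonomialPdLE.add_regular (ih (fun i hi => hf i (Finset.mem_insert_of_mem hi))
      fun i hi i' hi' => hdisj i (Finset.mem_insert_of_mem hi) i' (Finset.mem_insert_of_mem hi'))
      (f j) ?_ using 1
    · ext α
      simp only [Finset.exists_mem_insert, Set.mem_ofPred_eq]
      rw [or_assoc, or_comm (a := f j ≤ α)]
    · rintro α (hα | ⟨i, hi, hα⟩)
      · exact Or.inl (hf j (Finset.mem_insert_self _ _) α hα)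
      · refine Or.inr ⟨i, hi, fun v => ?_⟩
        have hij : i ≠ j := fun h => hj (h ▸ hi)
        have hv := hα v
        rw [Finsupp.add_apply] at hv
        have := hdisj i (Finset.mem_insert_of_mem hi) j (Finset.mem_insert_self _ _) hij v
        omega

theorem isUpperSet_setOf_erase (hU : IsUpperSet U) (v : V) :
    IsUpperSet {α : V →₀ ℕ | α.erase v ∈ U} :=
  fun α β hαβ hα => hU (fun u => by
    classical
    by_cases huv : u = v
    · simp [huv]
    · simp [Finsupp.erase_ne huv, hαβ u]) hα

theorem MonomialPdLE.or_single_le {v : V} (h : MonomialPdLE k {α | α.erase v ∈ U} n) :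
    MonomialPdLE k {α | α ∈ U ∨ Finsupp.single v 1 ≤ α} (n + 1) := by
  convert h.add_regular (Finsupp.single v 1) ?_ using 1
  · ext α
    refine or_congr_left' fun hα => ?_
    have : α.erase v = α := Finsupp.erase_of_notMem_support (by simpa using hα)
    rw [Set.mem_ofPred_eq, this]
  · intro α hα
    simpa [Finsupp.erase_add] using hα

/-- A form of Hilbert's syzygy theorem: if a monomial ideal is generated by monomials in the
variables from `W`, then its quotient has projective dimension at most `#W`. -/
theorem monomialPdLE_card (W : Finset V) (hU : IsUpperSet U)
    (hW : ∀ α β, (∀ v ∈ W, α v = β v) → α ∈ U → β ∈ U) {d : ℕ}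
    (hd : ∀ v ∈ W, ∀ α, d ≤ α v → α + Finsupp.single v 1 ∈ U → α ∈ U) :
    MonomialPdLE k U W.card := by
  classical
  induction W using Finset.induction_on generalizing U with
  | empty =>
    rcases U.eq_empty_or_nonempty with rfl | ⟨α, hα⟩
    · exact monomialPdLE_empty
    · rw [Set.eq_univ_of_forall fun β => hW α β (by simp) hα]
      exact monomialPdLE_univ
  | insert v W hv ih =>
    rw [Finset.card_insert_of_notMem hv]
    have key (e : ℕ) : ∀ U : Set (V →₀ ℕ), IsUpperSet U →
        (∀ α β, (∀ u ∈ insert v W, α u = β u) → α ∈ U → β ∈ U) →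
        (∀ u ∈ W, ∀ α, d ≤ α u → α + Finsupp.single u 1 ∈ U → α ∈ U) →
        (∀ α, e ≤ α v → α + Finsupp.single v 1 ∈ U → α ∈ U) →
        MonomialPdLE k U (W.card + 1) := by
      induction e with
      | zero =>
        intro U hU hW hd he
        refine (ih hU (fun α β hαβ hα => ?_) hd).mono (Nat.le_succ _)
        have hmem (i : ℕ) : ∀ γ, γ + Finsupp.single v i ∈ U → γ ∈ U := by
          induction i with
          | zero => simp
          | succ i ih =>
            intro γ hγ
            rw [Finsupp.single_add, ← add_assoc] at hγ
            exact ih _ (he _ (Nat.zero_le _) hγ)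
        refine hmem (α v) β (hW (α + Finsupp.single v (β v)) _ (fun u hu => ?_)
          (hU (le_add_of_nonneg_right zero_le) hα))
        rcases Finset.mem_insert.1 hu with rfl | hu
        · simp [add_comm]
        · have : v ≠ u := fun h => hv (h ▸ hu)
          simp [hαβ u hu, Finsupp.single_eq_of_ne' this]
      | succ e ihe =>
        intro U hU hW hd he
        refine MonomialPdLE.of_colon hU (Finsupp.single v 1) (ihe _ ?_ ?_ ?_ ?_)
          (MonomialPdLE.or_single_le (ih (isUpperSet_setOf_erase hU v) ?_ ?_))
        · exact fun α β hαβ hα => hU (add_le_add_right hαβ _) hα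
        · exact fun α β hαβ hα => hW _ _ (fun u hu => by simp [hαβ u hu]) hα
        · intro u hu α hα h
          refine hd u hu _ (hα.trans (by simp)) ?_
          rw [add_assoc]
          exact h
        · intro α hα h
          refine he _ (by simpa [add_comm 1] using hα) ?_
          rw [add_assoc]
          exact h
        · refine fun α β hαβ hα => hW _ _ (fun u hu => ?_) hα
          rcases Finset.mem_insert.1 hu with rfl | hu
          · simp
          · have : u ≠ v := fun h => hv (h ▸ hu)
            simp [Finsupp.erase_ne this, hαβ u hu]
        · intro u hu α hα h
          have : u ≠ v := fun h => hv (h ▸ hu)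
          refine hd u hu _ (by rwa [Finsupp.erase_ne this]) ?_
          simpa [Finsupp.erase_add, Finsupp.erase_single_ne this.symm] using h
    exact key d U hU hW (fun u hu => hd u (Finset.mem_insert_of_mem hu))
      (hd v (Finset.mem_insert_self _ _))

end MonomialIdeal

section UpperBound

variable {k V : Type} [Field k]

/-- The exponents of the edge ideal of the weighted oriented graph on `A` with an edge from `x` to
`y` whenever `p y = p x + 1`. -/
def layeredSet (p w : V → ℕ) (A : Finset V) : Set (V →₀ ℕ) :=
  {α | ∃ x ∈ A, ∃ y ∈ A, p y = p x + 1 ∧ 1 ≤ α x ∧ w y ≤ α y}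

theorem isUpperSet_layeredSet (p w : V → ℕ) (A : Finset V) : IsUpperSet (layeredSet p w A) := by
  rintro α β hαβ ⟨x, hx, y, hy, hxy, h1, h2⟩
  exact ⟨x, hx, y, hy, hxy, h1.trans (hαβ x), h2.trans (hαβ y)⟩

theorem le_add_single_iff {α : V →₀ ℕ} {u v : V} {c d : ℕ} (hd : d ≤ α v) (hcd : c ≤ d) :
    c ≤ (α + Finsupp.single v 1 : V →₀ ℕ) u ↔ c ≤ α u := by
  classical
  by_cases h : v = u
  · subst h
    simp only [Finsupp.add_apply, Finsupp.single_eq_same]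
    omega
  · simp [Finsupp.single_eq_of_ne' h]

theorem monomialPdLE_layeredSet (p w : V → ℕ) (hw : ∀ x, 1 ≤ w x) {d : ℕ} (hd : ∀ x, w x ≤ d)
    (A : Finset V) : MonomialPdLE k (layeredSet p w A) (A.card - 1) := by
  classical
  induction A using Finset.strongInduction with
  | H A ih =>
  rcases Nat.lt_or_ge 1 A.card with hA | hA
  swap
  · have : layeredSet p w A = ∅ := by
      refine Set.eq_empty_of_forall_notMem ?_
      rintro α ⟨x, hx, y, hy, hxy, -⟩
      rw [Finset.card_le_one.1 hA y hy x hx] at hxy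
      omega
    rw [this]
    exact monomialPdLE_empty.mono (Nat.zero_le _)
  obtain ⟨v, hvA, hv⟩ := A.exists_min_image p (Finset.card_pos.1 (Nat.zero_lt_of_lt hA))
  have hsrc {x y : V} (hx : x ∈ A) (hxy : p y = p x + 1) : v ≠ y := by
    rintro rfl
    have := hv x hx
    omega
  refine MonomialPdLE.of_colon (isUpperSet_layeredSet p w A) (Finsupp.single v 1) ?_ ?_
  · rw [← Finset.card_erase_of_mem hvA]
    refine monomialPdLE_card (d := d) _ (fun α β h hα => ?_) ?_ ?_
    · exact isUpperSet_layeredSet p w A (add_le_add_right h _) hα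
    · rintro α β h ⟨x, hx, y, hy, hxy, h1, h2⟩
      refine ⟨x, hx, y, hy, hxy, ?_, ?_⟩
      · by_cases hxv : x = v
        · simp [hxv]
        · simpa [← h x (Finset.mem_erase.2 ⟨hxv, hx⟩)] using h1
      · simpa [← h y (Finset.mem_erase.2 ⟨(hsrc hx hxy).symm, hy⟩)] using h2
    · rintro u hu α hα ⟨x, hx, y, hy, hxy, h1, h2⟩
      have hα' : d ≤ (Finsupp.single v 1 + α : V →₀ ℕ) u := hα.trans (by simp)
      rw [← add_assoc, le_add_single_iff hα' ((hw x).trans (hd x))] at h1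
      rw [← add_assoc, le_add_single_iff hα' (hd y)] at h2
      exact ⟨x, hx, y, hy, hxy, h1, h2⟩
  · have heq : {α | α ∈ layeredSet p w A ∨ Finsupp.single v 1 ≤ α} =
        {α | α ∈ layeredSet p w (A.erase v) ∨ Finsupp.single v 1 ≤ α} := by
      ext α
      refine or_congr_left' fun hα => ⟨?_, ?_⟩
      · rintro ⟨x, hx, y, hy, hxy, h1, h2⟩
        refine ⟨x, Finset.mem_erase.2 ⟨?_, hx⟩, y,
          Finset.mem_erase.2 ⟨(hsrc hx hxy).symm, hy⟩, hxy, h1, h2⟩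
        rintro rfl
        exact hα (by simpa using h1)
      · rintro ⟨x, hx, y, hy, hxy, h1, h2⟩
        exact ⟨x, Finset.mem_of_mem_erase hx, y, Finset.mem_of_mem_erase hy, hxy, h1, h2⟩
    rw [heq]
    have hcard : A.card - 1 = (A.erase v).card - 1 + 1 := by
      rw [Finset.card_erase_of_mem hvA]
      omega
    rw [hcard]
    refine (ih _ (Finset.erase_ssubset hvA)).add_regular _ ?_
    rintro α ⟨x, hx, y, hy, hxy, h1, h2⟩
    refine ⟨x, hx, y, hy, hxy, ?_, ?_⟩
    · simpa [Finsupp.single_eq_of_ne (Finset.ne_of_mem_erase hx)] using h1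
    · simpa [Finsupp.single_eq_of_ne (Finset.ne_of_mem_erase hy)] using h2

theorem single_add_single_le_iff {x y : V} (hxy : x ≠ y) (c d : ℕ) (α : V →₀ ℕ) :
    Finsupp.single x c + Finsupp.single y d ≤ α ↔ c ≤ α x ∧ d ≤ α y := by
  classical
  constructor
  · intro h
    have hx := h x
    have hy := h y
    simp only [Finsupp.add_apply, Finsupp.single_eq_same, Finsupp.single_eq_of_ne hxy,
      Finsupp.single_eq_of_ne' hxy] at hx hy
    omega
  · rintro ⟨hx, hy⟩ v
    by_cases hvx : v = x
    · subst hvx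
      simpa [Finsupp.single_eq_of_ne hxy] using hx
    · by_cases hvy : v = y
      · subst hvy
        simpa [Finsupp.single_eq_of_ne hvx] using hy
      · simp [Finsupp.single_eq_of_ne hvx, Finsupp.single_eq_of_ne hvy]

/-- The exponents of the edge ideal `I(D)`. -/
def edgeSet (E : Set (V × V)) (w : V → ℕ) : Set (V →₀ ℕ) :=
  {α | ∃ e ∈ E, 1 ≤ α e.1 ∧ w e.2 ≤ α e.2}

theorem mem_edgeIdeal_iff {E : Set (V × V)} (hE : ∀ e ∈ E, e.1 ≠ e.2) (w : V → ℕ)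
    {p : MvPolynomial V k} :
    p ∈ WOG.edgeIdeal k E w ↔ ∀ α, coeff α p ≠ 0 → α ∈ edgeSet E w := by
  have : {p : MvPolynomial V k | ∃ e ∈ E, p = X e.1 * X e.2 ^ w e.2} =
      (fun α => monomial α 1) '' ((fun e : V × V =>
        Finsupp.single e.1 1 + Finsupp.single e.2 (w e.2)) '' E) := by
    ext p
    simp only [Set.mem_ofPred_eq, Set.mem_image, exists_exists_and_eq_and]
    refine exists_congr fun e => and_congr_right fun _ => ?_
    rw [X_pow_eq_monomial, X, monomial_mul, one_mul, eq_comm]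
  rw [WOG.edgeIdeal, this, mem_ideal_span_monomial_image]
  refine forall_congr' fun α => ?_
  rw [mem_support_iff]
  refine imp_congr_right fun _ => ?_
  simp only [Set.exists_mem_image]
  exact exists_congr fun e => and_congr_right fun he => single_add_single_le_iff (hE e he) _ _ _

theorem MonomialPdLE.edgeIdeal {E : Set (V × V)} (hE : ∀ e ∈ E, e.1 ≠ e.2) {w : V → ℕ} {n : ℕ}
    (h : MonomialPdLE k (edgeSet E w) n) : PdQuotLE (WOG.edgeIdeal k E w) n := by
  obtain ⟨hU, h⟩ := h
  have : WOG.edgeIdeal k E w = restrictSupportIdeal k (edgeSet E w) hU := by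
    ext p
    rw [mem_edgeIdeal_iff hE, mem_restrictSupportIdeal_iff]
  rwa [this]

/-- The edges of a graph of the second class, its layers being numbered from `0` by `p`. -/
def secondClassEdges (p : V → ℕ) (σ : {x : V // p x = 0} → V) : Set (V × V) :=
  {e | (∃ a : {x : V // p x = 0}, e.1 = σ a ∧ e.2 = (a : V)) ∨ (1 ≤ p e.1 ∧ p e.2 = p e.1 + 1)}

theorem fst_ne_snd_of_mem_secondClassEdges {p : V → ℕ} {σ : {x : V // p x = 0} → V}
    (hσ : ∀ a, p (σ a) = 1) (e : V × V) (he : e ∈ secondClassEdges p σ) : e.1 ≠ e.2 := by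
  intro h
  rcases he with ⟨a, h1, h2⟩ | ⟨h1, h2⟩
  · have := hσ a
    rw [← h1, h, h2, a.2] at this
    omega
  · rw [h] at h2
    omega

theorem monomialPdLE_edgeSet [Fintype V] {p w : V → ℕ} {σ : {x : V // p x = 0} → V}
    (hσinj : Function.Injective σ) (hσ : ∀ a, p (σ a) = 1) (hw : ∀ x, 1 ≤ w x) {n : ℕ}
    (h₀ : Nat.card {x // p x = 0} + Nat.card {x // 2 ≤ p x} ≤ n)
    (h₁ : Nat.card {x // p x = 1} + (Nat.card {x // 2 ≤ p x} - 1) ≤ n)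
    (h₂ : Nat.card {x // p x = 1} + Nat.card {x // 2 ≤ p x} ≤ n + 1) :
    MonomialPdLE k (edgeSet (secondClassEdges p σ) w) n := by
  classical
  let L : Finset V := Finset.univ.filter fun x => 2 ≤ p x
  let Y : Finset V := Finset.univ.filter fun x => p x = 1
  have hL {x : V} : x ∈ L ↔ 2 ≤ p x := by simp [L]
  have hY {x : V} : x ∈ Y ↔ p x = 1 := by simp [Y]
  have hLcard : Nat.card {x // 2 ≤ p x} = L.card := by
    rw [Nat.card_eq_fintype_card, Fintype.card_subtype]
  have hYcard : Nat.card {x // p x = 1} = Y.card := by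
    rw [Nat.card_eq_fintype_card, Fintype.card_subtype]
  rw [Nat.card_eq_fintype_card, ← Finset.card_univ] at h₀
  rw [hLcard] at h₀
  rw [hLcard, hYcard] at h₁ h₂
  let J : Set (V →₀ ℕ) := layeredSet p w L
  let Z : Set (V →₀ ℕ) := {α | α ∈ J ∨ ∃ z, p z = 2 ∧ w z ≤ α z}
  have hd (x : V) : w x ≤ Finset.univ.sup w := Finset.le_sup (Finset.mem_univ x)
  have hJ : MonomialPdLE k J (L.card - 1) := monomialPdLE_layeredSet p w hw hd L
  have hZupper : IsUpperSet Z := by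
    rintro α β hαβ (hα | ⟨z, hz, hα⟩)
    · exact Or.inl (isUpperSet_layeredSet p w L hαβ hα)
    · exact Or.inr ⟨z, hz, hα.trans (hαβ z)⟩
  have hJdep {α β : V →₀ ℕ} (h : ∀ v ∈ L, α v = β v) (hα : α ∈ J) : β ∈ J := by
    obtain ⟨x, hx, y, hy, hxy, h1, h2⟩ := hα
    exact ⟨x, hx, y, hy, hxy, by rwa [← h x hx], by rwa [← h y hy]⟩
  have hZdep {α β : V →₀ ℕ} (h : ∀ v ∈ L, α v = β v) : α ∈ Z → β ∈ Z := by
    rintro (hα | ⟨z, hz, hα⟩)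
    · exact Or.inl (hJdep h hα)
    · exact Or.inr ⟨z, hz, by rwa [← h z (hL.2 hz.ge)]⟩
  have hZ : MonomialPdLE k Z L.card := by
    refine monomialPdLE_card (d := Finset.univ.sup w) L hZupper (fun α β h => hZdep h) ?_
    rintro u hu α hα (⟨x, hx, y, hy, hxy, h1, h2⟩ | ⟨z, hz, h1⟩)
    · rw [le_add_single_iff hα ((hw x).trans (hd x))] at h1
      rw [le_add_single_iff hα (hd y)] at h2
      exact Or.inl ⟨x, hx, y, hy, hxy, h1, h2⟩
    · rw [le_add_single_iff hα (hd z)] at h1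
      exact Or.inr ⟨z, hz, h1⟩
  let y' : V → V →₀ ℕ := fun y => Finsupp.single y 1
  have hy' {U : Set (V →₀ ℕ)} (hU : ∀ α β : V →₀ ℕ, (∀ v ∈ L, α v = β v) → α ∈ U → β ∈ U) :
      ∀ y ∈ Y, ∀ α, y' y + α ∈ U → α ∈ U := by
    refine fun y hy α => hU _ _ fun v hv => ?_
    have : v ≠ y := by
      rintro rfl
      rw [hL, hY.1 hy] at hv
      omega
    simp [y', Finsupp.single_eq_of_ne this]
  have hydisj : ∀ y ∈ Y, ∀ z ∈ Y, y ≠ z → ∀ v, y' y v = 0 ∨ y' z v = 0 := by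
    intro y _ z _ hyz v
    by_cases hv : v = y
    · subst hv
      exact Or.inr (Finsupp.single_eq_of_ne hyz)
    · exact Or.inl (Finsupp.single_eq_of_ne hv)
  let a' : {x : V // p x = 0} → V →₀ ℕ := fun a =>
    Finsupp.single (σ a) 1 + Finsupp.single (a : V) (w a)
  have ha' (a : {x : V // p x = 0}) {v : V} (h1 : v ≠ σ a) (h2 : v ≠ a) : a' a v = 0 := by
    simp [a', Finsupp.single_eq_of_ne h1, Finsupp.single_eq_of_ne h2]
  have hσa (a : {x : V // p x = 0}) : σ a ≠ a := by
    intro h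
    have := hσ a
    rw [h, a.2] at this
    omega
  have hA := hJ.add_regular_finset Y y' (hy' fun _ _ => hJdep) hydisj
  have hAB := hZ.add_regular_finset Y y' (hy' fun _ _ => hZdep) hydisj
  have hB := hZ.add_regular_finset Finset.univ a'
    (by
      refine fun a _ α => hZdep fun v hv => ?_
      rw [hL] at hv
      rw [Finsupp.add_apply, ha', zero_add]
      · rintro rfl
        rw [hσ] at hv
        omega
      · rintro rfl
        rw [a.2] at hv
        omega)
    (by
      intro a _ b _ hab v
      rw [or_iff_not_imp_left]
      intro hv
      have hv' : v = σ a ∨ v = a := by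
        by_contra! h
        exact hv (ha' a h.1 h.2)
      rcases hv' with rfl | rfl
      · refine ha' b (hσinj.ne hab) fun h => ?_
        have := hσ a
        rw [h, b.2] at this
        omega
      · refine ha' b (fun h => ?_) fun h => hab (Subtype.ext h)
        have := hσ b
        rw [← h, a.2] at this
        omega)
  convert (hA.mono (show _ ≤ n by omega)).inter (hB.mono (show _ ≤ n by omega))
    (by
      convert hAB.mono (show _ ≤ n + 1 by omega) using 1
      ext α
      simp only [Set.mem_union, Set.mem_ofPred_eq]
      constructor
      · rintro ((h | h) | (h | ⟨a, -, h⟩))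
        · exact Or.inl (Or.inl h)
        · exact Or.inr h
        · exact Or.inl h
        · refine Or.inr ⟨σ a, hY.2 (hσ a), ?_⟩
          simpa [y'] using ((single_add_single_le_iff (hσa a) _ _ _).1 h).1
      · rintro (h | h)
        · exact Or.inr (Or.inl h)
        · exact Or.inl (Or.inr h)) using 1
  ext α
  have hyα (y : V) : y' y ≤ α ↔ 1 ≤ α y := by simp [y']
  simp only [Set.mem_inter_iff, Set.mem_ofPred_eq, hyα, a', single_add_single_le_iff (hσa _)]
  constructor
  · rintro ⟨⟨x, y⟩, ⟨a, rfl, rfl⟩ | ⟨hx, hxy⟩, h1, h2⟩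
    · exact ⟨Or.inr ⟨σ a, hY.2 (hσ a), h1⟩, Or.inr ⟨a, Finset.mem_univ _, h1, h2⟩⟩
    · dsimp only at hx hxy h1 h2
      by_cases hx1 : p x = 1
      · exact ⟨Or.inr ⟨x, hY.2 hx1, h1⟩, Or.inl (Or.inr ⟨y, by omega, h2⟩)⟩
      · have : α ∈ J := ⟨x, hL.2 (by omega), y, hL.2 (by omega), hxy, h1, h2⟩
        exact ⟨Or.inl this, Or.inl (Or.inl this)⟩
  · have hJE : α ∈ J → α ∈ edgeSet (secondClassEdges p σ) w := by
      rintro ⟨x, hx, y, hy, hxy, h1, h2⟩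
      exact ⟨(x, y), Or.inr ⟨by have := hL.1 hx; dsimp only; omega, hxy⟩, h1, h2⟩
    rintro ⟨h | ⟨y, hy, h⟩, (h' | ⟨z, hz, h'⟩) | ⟨a, -, h', h''⟩⟩
    · exact hJE h
    · exact hJE h
    · exact hJE h
    · exact hJE h'
    · refine ⟨(y, z), Or.inr ?_, h, h'⟩
      rw [hY] at hy
      dsimp only
      omega
    · exact ⟨(σ a, a), Or.inl ⟨a, rfl, rfl⟩, h', h''⟩

end UpperBound

section Grade

theorem exists_smul_eq_of_subsingleton_ext {R M : Type} [CommRing R] [AddCommGroup M] [Module R M]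
    (P : Ideal R) (h : Subsingleton (Ext (ModuleCat.of R (R ⧸ P)) (ModuleCat.of R M) 1))
    (φ : P →ₗ[R] M) : ∃ g : M, ∀ x : P, φ x = (x : R) • g := by
  have hS := shortExact_of_linearMap (Submodule.subtype P) (Submodule.mkQ P)
    (Submodule.injective_subtype _) (Submodule.mkQ_surjective _) (LinearMap.exact_subtype_mkQ P)
  obtain ⟨x, hx⟩ := Ext.contravariant_sequence_exact₁ hS (ModuleCat.of R M)
    (Ext.mk₀ (ModuleCat.ofHom φ)) (n₁ := 1) rfl (Subsingleton.elim _ _)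
  obtain ⟨ψ, rfl⟩ := (Ext.mk₀_bijective _ _).2 x
  rw [Ext.mk₀_comp_mk₀] at hx
  have hφ := (Ext.mk₀_bijective _ _).1 hx
  refine ⟨ψ.hom (1 : R), fun x => ?_⟩
  have h1 : ψ.hom (x : R) = φ x := congrArg (fun f => f.hom x) hφ
  rw [← h1, ← map_smul, smul_eq_mul, mul_one]

variable {k V : Type} [Field k]

variable (k) in
/-- The ideal generated by the variables from `s`. -/
abbrev varIdeal (s : Set V) : Ideal (MvPolynomial V k) :=
  Ideal.span (X '' s)

theorem X_mul_mem_varIdeal_iff {s : Set V} {v : V} (hv : v ∉ s) {p : MvPolynomial V k} :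
    X v * p ∈ varIdeal k s ↔ p ∈ varIdeal k s := by
  refine ⟨fun h => ?_, Ideal.mul_mem_left _ _⟩
  rw [mem_ideal_span_X_image] at h ⊢
  intro α hα
  obtain ⟨i, hi, hαi⟩ := h (Finsupp.single v 1 + α)
    (by rwa [mem_support_iff, coeff_X_mul, ← mem_support_iff])
  have : i ≠ v := fun h => hv (h ▸ hi)
  exact ⟨i, hi, by simpa [Finsupp.single_eq_of_ne this] using hαi⟩

theorem isWeaklyRegular_X (ι : Type) {l : List V} (hl : l.Nodup) :
    RingTheory.Sequence.IsWeaklyRegular (ι →₀ MvPolynomial V k)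
      (l.map (X : V → MvPolynomial V k)) := by
  refine ⟨fun i hi => ?_⟩
  have hofList : Ideal.ofList ((l.map X).take i) =
      varIdeal k {v | v ∈ l.take i} := by
    rw [Ideal.ofList, ← List.map_take]
    congr 1
    ext p
    exact List.mem_map
  have htop (J : Ideal (MvPolynomial V k)) (x : ι →₀ MvPolynomial V k) :
      x ∈ J • (⊤ : Submodule (MvPolynomial V k) (ι →₀ MvPolynomial V k)) ↔ ∀ a, x a ∈ J := by
    have h := Finsupp.submodule_smul (MvPolynomial V k) ι
      (fun _ => (⊤ : Submodule (MvPolynomial V k) (MvPolynomial V k))) J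
    have htop : Finsupp.submodule
        (fun _ : ι => (⊤ : Submodule (MvPolynomial V k) (MvPolynomial V k))) = ⊤ := by
      ext
      simp
    rw [← htop, ← h, Finsupp.mem_submodule_iff]
    simp
  rw [isSMulRegular_quotient_iff_mem_of_smul_mem]
  intro x hx
  rw [hofList, htop] at hx ⊢
  intro a
  have hi' : i < l.length := by simpa using hi
  rw [← X_mul_mem_varIdeal_iff (v := l[i]) ?_]
  · simpa using hx a
  · intro hmem
    obtain ⟨j, hj, hji⟩ := List.mem_take_iff_getElem.1 hmem
    have := (hl.getElem_inj_iff).1 hji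
    omega

theorem subsingleton_ext_varIdeal (T : Finset V) (ι : Type) {i : ℕ} (hi : i < T.card) :
    Subsingleton (Ext (ModuleCat.of _ (MvPolynomial V k ⧸ varIdeal k (T : Set V)))
      (ModuleCat.of (MvPolynomial V k) (ι →₀ MvPolynomial V k)) i) := by
  refine subsingleton_ext_of_isWeaklyRegular _ (T.toList.map X) _ ?_
    (isWeaklyRegular_X ι T.nodup_toList) i (by simpa using hi)
  intro r hr
  obtain ⟨v, hv, rfl⟩ := List.mem_map.1 hr
  change _ ∈ Module.annihilator _ (MvPolynomial V k ⧸ varIdeal k (T : Set V))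
  rw [Ideal.annihilator_quotient]
  exact Ideal.subset_span ⟨v, by simpa using hv, rfl⟩

variable {I : Ideal (MvPolynomial V k)}

theorem WOG.MinFreeRes.nonempty_of_forall_X_mul_mem (R : MinFreeRes I) (T : Finset V)
    {F : MvPolynomial V k} (hF : F ∉ I) (hT : ∀ v ∈ T, X v * F ∈ I) {p : ℕ}
    (hp : p + 1 ≤ T.card) : Nonempty (R.ι p) := by
  by_contra hne
  rw [not_nonempty_iff] at hne
  have hext := R.subsingleton_ext_ideal_quotient _ hne
    (fun ι i hi => subsingleton_ext_varIdeal T ι hi) (j := 0) (by omega)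
  have hhom : Subsingleton
      ((MvPolynomial V k ⧸ varIdeal k (T : Set V)) →ₗ[MvPolynomial V k]
        (MvPolynomial V k ⧸ I)) :=
    (Ext.addEquiv₀.trans (ModuleCat.homAddEquiv (M := ModuleCat.of (MvPolynomial V k) _)
      (N := ModuleCat.of (MvPolynomial V k) _))).symm.subsingleton
  let φ := Submodule.liftQ (varIdeal k (T : Set V))
    (LinearMap.toSpanSingleton (MvPolynomial V k) (MvPolynomial V k ⧸ I)
      (Ideal.Quotient.mk I F)) (by
    refine Submodule.span_le.2 ?_
    rintro _ ⟨v, hv, rfl⟩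
    exact Ideal.Quotient.eq_zero_iff_mem.2 (hT v hv))
  have h1 := LinearMap.congr_fun (Subsingleton.elim φ 0) (Submodule.Quotient.mk 1)
  refine hF (Ideal.Quotient.eq_zero_iff_mem.1 ?_)
  exact (one_smul (MvPolynomial V k) _).symm.trans h1

variable (k) in
theorem exists_algHom_X_eq_zero (Q : Set V) :
    ∃ ρ : MvPolynomial V k →ₐ[k] MvPolynomial V k, (∀ v ∈ Q, ρ (X v) = 0) ∧
      (∀ v ∉ Q, ρ (X v) = X v) ∧ ∀ s, ρ s - s ∈ varIdeal k Q := by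
  classical
  obtain ⟨ρ, h₀, h₁⟩ : ∃ ρ : MvPolynomial V k →ₐ[k] MvPolynomial V k,
      (∀ v ∈ Q, ρ (X v) = 0) ∧ ∀ v ∉ Q, ρ (X v) = X v :=
    ⟨aeval fun v => if v ∈ Q then 0 else X v, fun v hv => by simp [hv], fun v hv => by simp [hv]⟩
  refine ⟨ρ, h₀, h₁, fun s => ?_⟩
  have h : (Ideal.Quotient.mkₐ k (varIdeal k Q)).comp ρ = Ideal.Quotient.mkₐ k (varIdeal k Q) := by
    refine MvPolynomial.algHom_ext fun v => ?_
    by_cases hv : v ∈ Q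
    · rw [AlgHom.comp_apply, h₀ v hv, map_zero, eq_comm]
      exact Ideal.Quotient.eq_zero_iff_mem.2 (Ideal.subset_span ⟨v, hv, rfl⟩)
    · rw [AlgHom.comp_apply, h₁ v hv]
  exact Ideal.Quotient.eq.1 (DFunLike.congr_fun h s)

theorem exists_mul_sub_mul_mem_of_subsingleton_ext {R : Type} [CommRing R] {I P : Ideal R}
    (hext : Subsingleton (Ext (ModuleCat.of R (R ⧸ P)) (ModuleCat.of R (R ⧸ I)) 1))
    (ρ : R →+* R) (F : R) (h : ∀ r, ∀ s ∈ P, (ρ r - r) * ρ s * F ∈ I) :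
    ∃ G, ∀ s ∈ P, ρ s * F - s * G ∈ I := by
  let φ : P →ₗ[R] (R ⧸ I) :=
    { toFun := fun s => Ideal.Quotient.mk I (ρ s * F)
      map_add' := fun s t => by rw [Submodule.coe_add, map_add, add_mul, map_add]
      map_smul' := fun r s => by
        have := h r s s.2
        rw [sub_mul, sub_mul, mul_assoc r, ← map_mul ρ] at this
        exact Ideal.Quotient.eq.2 this }
  obtain ⟨g, hg⟩ := exists_smul_eq_of_subsingleton_ext P hext φ
  obtain ⟨G, rfl⟩ := Ideal.Quotient.mk_surjective g
  exact ⟨G, fun s hs => Ideal.Quotient.eq.1 (hg ⟨s, hs⟩)⟩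

/-- If `F` is killed modulo `I` by all the products `x * y` with `x ∈ Q` and `y ∈ Y`, then the
obstruction to finding `G` which agrees with `F` on `Y` and is killed by `Q` is an `Ext¹` class. -/
theorem WOG.MinFreeRes.exists_X_mul_mem_of_isEmpty (R : MinFreeRes I) {Q Y : Finset V}
    (hQY : Disjoint Q Y) {i : ℕ} (hi : i + 2 ≤ Q.card + Y.card) (hne : IsEmpty (R.ι i))
    {F : MvPolynomial V k} (hF : ∀ x ∈ Q, ∀ y ∈ Y, X x * X y * F ∈ I) :
    ∃ G, (∀ x ∈ Q, X x * G ∈ I) ∧ ∀ y ∈ Y, X y * (F - G) ∈ I := by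
  classical
  obtain ⟨T, hT⟩ : ∃ T, T = Q ∪ Y := ⟨_, rfl⟩
  obtain ⟨ρ, h₀, h₁, hρ⟩ := exists_algHom_X_eq_zero k (Q : Set V)
  have hρY : ∀ s ∈ varIdeal k (T : Set V), ρ s ∈ varIdeal k (Y : Set V) := by
    have hle : varIdeal k (T : Set V) ≤ (varIdeal k (Y : Set V)).comap ρ := by
      refine Ideal.span_le.2 ?_
      rintro _ ⟨v, hv, rfl⟩
      change ρ (X v) ∈ varIdeal k (Y : Set V)
      by_cases hvQ : v ∈ Q
      · rw [h₀ v hvQ]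
        exact zero_mem _
      · rw [h₁ v hvQ]
        rw [hT] at hv
        exact Ideal.subset_span ⟨v, (Finset.mem_union.1 hv).resolve_left hvQ, rfl⟩
    exact fun s hs => hle hs
  have hmul : ∀ q ∈ varIdeal k (Q : Set V), ∀ r ∈ varIdeal k (Y : Set V), q * r * F ∈ I := by
    have hle : varIdeal k (Q : Set V) * varIdeal k (Y : Set V) ≤
        Submodule.comap (LinearMap.mulRight (MvPolynomial V k) F) I := by
      rw [Ideal.span_mul_span', Ideal.span, Submodule.span_le]
      rintro _ ⟨_, ⟨x, hx, rfl⟩, _, ⟨y, hy, rfl⟩, rfl⟩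
      exact hF x hx y hy
    exact fun q hq r hr => hle (Ideal.mul_mem_mul hq hr)
  rw [← Finset.card_union_of_disjoint hQY, ← hT] at hi
  obtain ⟨G, hG⟩ := exists_mul_sub_mul_mem_of_subsingleton_ext
    (R.subsingleton_ext_ideal_quotient _ hne
      (fun ι _ hi => subsingleton_ext_varIdeal T ι hi) (by omega))
    ρ.toRingHom F (fun r s hs => hmul _ (hρ r) _ (hρY s hs))
  replace hG : ∀ v ∈ T, ρ (X v) * F - X v * G ∈ I := fun v hv =>
    hG _ (Ideal.subset_span ⟨v, hv, rfl⟩)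
  subst hT
  refine ⟨G, fun x hx => ?_, fun y hy => ?_⟩
  · have := hG x (Finset.mem_union_left _ hx)
    rw [h₀ x hx, zero_mul, zero_sub] at this
    exact neg_mem_iff.1 this
  · have := hG y (Finset.mem_union_right _ hy)
    rwa [h₁ y (Finset.disjoint_right.1 hQY hy), ← mul_sub] at this

end Grade

section LowerBound

variable {k V : Type} [Field k] {p w : V → ℕ} {σ : {x : V // p x = 0} → V}

theorem monomial_mem_edgeIdeal_iff {E : Set (V × V)} (hE : ∀ e ∈ E, e.1 ≠ e.2) {f : V →₀ ℕ} :
    monomial f (1 : k) ∈ WOG.edgeIdeal k E w ↔ f ∈ edgeSet E w := by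
  classical
  rw [mem_edgeIdeal_iff hE]
  constructor
  · intro h
    exact h f (by simp)
  · intro h α hα
    rw [coeff_monomial] at hα
    rwa [← (ite_ne_right_iff.1 hα).1]

theorem X_mul_monomial_mem_edgeIdeal_iff {E : Set (V × V)} (hE : ∀ e ∈ E, e.1 ≠ e.2)
    {f : V →₀ ℕ} {v : V} :
    X v * monomial f (1 : k) ∈ WOG.edgeIdeal k E w ↔ Finsupp.single v 1 + f ∈ edgeSet E w := by
  rw [X, monomial_mul, one_mul, monomial_mem_edgeIdeal_iff hE]

theorem exists_edge_of_two_le (hp : ∀ x, 2 ≤ p x → ∃ u, p x = p u + 1)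
    (hlarge : ∀ u v, 2 ≤ p u → p v = p u + 1 → 2 ≤ w u) {f : V →₀ ℕ}
    (hf : ∀ x, 2 ≤ p x → f x = w x - 1) {v y : V} (hv : 2 ≤ p v)
    (hy : p y = 1) (hfy : 1 ≤ f y) :
    Finsupp.single v 1 + f ∈ edgeSet (secondClassEdges p σ) w := by
  have hwv : w v ≤ (Finsupp.single v 1 + f : V →₀ ℕ) v := by
    simp only [Finsupp.add_apply, Finsupp.single_eq_same, hf v hv]
    omega
  by_cases hv2 : p v = 2
  · exact ⟨(y, v), Or.inr (by dsimp only; omega),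
      hfy.trans (by simp), hwv⟩
  · obtain ⟨u, hu⟩ := hp v hv
    have h2 := hlarge u v (by omega) hu
    have hfu := hf u (by omega)
    exact ⟨(u, v), Or.inr (by dsimp only; omega),
      (show 1 ≤ f u by omega).trans (by simp), hwv⟩

/-- The case of a perfect matching between the first two layers. -/
theorem nonempty_of_surjective [Fintype V] (hσ : ∀ a, p (σ a) = 1) (hσinj : Function.Injective σ)
    (hsurj : ∀ y, p y = 1 → ∃ a, σ a = y) (hp : ∀ x, 2 ≤ p x → ∃ u, p x = p u + 1)
    (hlarge : ∀ u v, 2 ≤ p u → p v = p u + 1 → 2 ≤ w u) (hw : ∀ x, 1 ≤ w x)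
    (a₀ : {x : V // p x = 0})
    (R : WOG.MinFreeRes (WOG.edgeIdeal k (secondClassEdges p σ) w)) {i : ℕ}
    (hi : i + 1 ≤ Nat.card {x // p x ≠ 0}) : Nonempty (R.ι i) := by
  classical
  have hE := fst_ne_snd_of_mem_secondClassEdges hσ
  let f : V →₀ ℕ := Finsupp.equivFunOnFinite.symm fun x =>
    if x = a₀ then w x - 1 else if p x = 0 then w x else if x = σ a₀ then 1
      else if 2 ≤ p x then w x - 1 else 0
  have ha₀ := a₀.2
  have hσa₀ := hσ a₀
  have hne {x : V} (hx : p x ≠ 0) : x ≠ a₀ := by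
    rintro rfl
    exact hx ha₀
  have hf₀ : f a₀ = w a₀ - 1 := by simp [f]
  have hf₀' {x : V} (hx : x ≠ a₀) (hpx : p x = 0) : f x = w x := by simp [f, hx, hpx]
  have hfσ : f (σ a₀) = 1 := by simp [f, hne (x := σ a₀) (by omega), hσa₀]
  have hf₁ {x : V} (hx : x ≠ σ a₀) (hpx : p x = 1) : f x = 0 := by
    simp [f, hne (x := x) (by omega), hx, hpx]
  have hf₂ (x : V) (hpx : 2 ≤ p x) : f x = w x - 1 := by
    have h1 : x ≠ σ a₀ := by
      rintro rfl
      omega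
    have h2 : p x ≠ 0 := by omega
    simp [f, hne h2, h1, h2, hpx]
  let T : Finset V := insert (a₀ : V) ((Finset.univ.filter fun x => p x ≠ 0).erase (σ a₀))
  have hT : T.card = Nat.card {x // p x ≠ 0} := by
    rw [Finset.card_insert_of_notMem (by simp [ha₀]),
      Finset.card_erase_add_one (by simp [hσa₀]), Nat.card_eq_fintype_card, Fintype.card_subtype]
  refine R.nonempty_of_forall_X_mul_mem T (F := monomial f 1) ?_ (fun v hv => ?_) (hT ▸ hi)
  · rw [monomial_mem_edgeIdeal_iff hE]
    rintro ⟨⟨x, y⟩, ⟨a, rfl, rfl⟩ | ⟨hx, hxy⟩, h1, h2⟩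
    · by_cases ha : a = a₀
      · subst ha
        dsimp only at h2
        have := hw a
        omega
      · dsimp only at h1
        rw [hf₁ (hσinj.ne ha) (hσ a)] at h1
        omega
    · dsimp only at hx hxy h2
      rw [hf₂ y (by omega)] at h2
      have := hw y
      omega
  · rw [X_mul_monomial_mem_edgeIdeal_iff hE]
    rcases Finset.mem_insert.1 hv with rfl | hv
    · refine ⟨(σ a₀, a₀), Or.inl ⟨a₀, rfl, rfl⟩, ?_, ?_⟩
      · simp [hfσ]
      · simp only [Finsupp.add_apply, Finsupp.single_eq_same, hf₀]
        omega
    · obtain ⟨hvσ, hv⟩ := Finset.mem_erase.1 hv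
      have hv0 : p v ≠ 0 := by simpa using hv
      by_cases hv1 : p v = 1
      · obtain ⟨a, rfl⟩ := hsurj v hv1
        refine ⟨(σ a, a), Or.inl ⟨a, rfl, rfl⟩, by simp, ?_⟩
        have ha : (a : V) ≠ a₀ := fun h => hvσ (congrArg σ (Subtype.ext h))
        simp [hf₀' ha a.2]
      · exact exists_edge_of_two_le hp hlarge hf₂ (by omega) hσa₀ hfσ.ge

/-- The case where the matching does not cover the second layer. -/
theorem nonempty_of_not_surjective [Fintype V] (hσ : ∀ a, p (σ a) = 1)
    (hp : ∀ x, 2 ≤ p x → ∃ u, p x = p u + 1)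
    (hlarge : ∀ u v, 2 ≤ p u → p v = p u + 1 → 2 ≤ w u) (hw : ∀ x, 1 ≤ w x)
    {y₀ z : V} (hy₀ : p y₀ = 1) (hy₀σ : ∀ a, σ a ≠ y₀) (hz : p z = 2)
    (R : WOG.MinFreeRes (WOG.edgeIdeal k (secondClassEdges p σ) w)) {i : ℕ}
    (hi : i + 2 ≤ Nat.card {x // p x ≠ 0}) : Nonempty (R.ι i) := by
  classical
  have hE := fst_ne_snd_of_mem_secondClassEdges hσ
  by_contra hne
  rw [not_nonempty_iff] at hne
  let f : V →₀ ℕ := Finsupp.equivFunOnFinite.symm fun x =>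
    if p x = 0 then w x else if 2 ≤ p x then w x - 1 else 0
  have hf₀ {x : V} (hpx : p x = 0) : f x = w x := by simp [f, hpx]
  have hf₁ {x : V} (hpx : p x = 1) : f x = 0 := by simp [f, hpx]
  have hf₂ (x : V) (hpx : 2 ≤ p x) : f x = w x - 1 := by
    simp [f, hpx, show p x ≠ 0 by omega]
  let Y : Finset V := Finset.univ.filter fun y => p y = 1 ∧ ∀ a, σ a ≠ y
  let Q : Finset V := Finset.univ.filter fun v => p v ≠ 0 ∧ ¬(p v = 1 ∧ ∀ a, σ a ≠ v)
  have hY {v : V} : v ∈ Y ↔ p v = 1 ∧ ∀ a, σ a ≠ v := by simp [Y]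
  have hQ {v : V} : v ∈ Q ↔ p v ≠ 0 ∧ ¬(p v = 1 ∧ ∀ a, σ a ≠ v) := by
    simp only [Q, Finset.mem_filter, Finset.mem_univ, true_and]
  have hQY : Disjoint Q Y := Finset.disjoint_left.2 fun v hv hv' => (hQ.1 hv).2 (hY.1 hv')
  have hcard : Nat.card {x // p x ≠ 0} = Q.card + Y.card := by
    rw [← Finset.card_union_of_disjoint hQY, Nat.card_eq_fintype_card, Fintype.card_subtype]
    congr 1
    ext v
    simp only [Finset.mem_filter, Finset.mem_univ, true_and, Finset.mem_union, hQ, hY]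
    refine ⟨fun h => ?_, ?_⟩
    · by_cases hv : p v = 1 ∧ ∀ a, σ a ≠ v
      · exact Or.inr hv
      · exact Or.inl ⟨h, hv⟩
    · rintro (h | h) <;> omega
  obtain ⟨G, hGQ, hGY⟩ := R.exists_X_mul_mem_of_isEmpty hQY (hcard ▸ hi) hne
    (F := monomial f 1) (by
      intro v hv y hy
      rw [hQ] at hv
      rw [hY] at hy
      by_cases hv1 : p v = 1
      · obtain ⟨a, rfl⟩ : ∃ a, σ a = v := by
          by_contra! h
          exact hv.2 ⟨hv1, h⟩
        rw [mul_right_comm]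
        refine Ideal.mul_mem_right _ _ ((X_mul_monomial_mem_edgeIdeal_iff hE).2 ?_)
        refine ⟨(σ a, a), Or.inl ⟨a, rfl, rfl⟩, by simp, ?_⟩
        simp [hf₀ a.2]
      · have hX : X y * monomial f (1 : k) = monomial (Finsupp.single y 1 + f) 1 := by
          rw [X, monomial_mul, one_mul]
        rw [mul_assoc, hX, X_mul_monomial_mem_edgeIdeal_iff hE]
        refine exists_edge_of_two_le hp hlarge (fun x hx => ?_) (by omega) hy.1 (by simp)
        have : x ≠ y := by
          rintro rfl
          omega
        simp [Finsupp.single_eq_of_ne this, hf₂ x hx])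
  have hy₀Y : y₀ ∈ Y := hY.2 ⟨hy₀, hy₀σ⟩
  have hGf : coeff f G = 1 := by
    have h := hGY y₀ hy₀Y
    rw [mem_edgeIdeal_iff hE] at h
    by_contra hc
    obtain ⟨⟨x, y⟩, ⟨a, rfl, rfl⟩ | ⟨hx, hxy⟩, h1, h2⟩ := h (Finsupp.single y₀ 1 + f) (by
      rw [coeff_X_mul, coeff_sub, coeff_monomial, if_pos rfl]
      exact sub_ne_zero.2 (Ne.symm hc))
    · simp [Finsupp.single_eq_of_ne (hy₀σ a), hf₁ (hσ a)] at h1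
    · dsimp only at hx hxy h2
      have hyy : y ≠ y₀ := by
        rintro rfl
        omega
      have := hw y
      simp only [Finsupp.add_apply, Finsupp.single_eq_of_ne hyy, hf₂ y (by omega)] at h2
      omega
  have h := hGQ z (hQ.2 (by omega))
  rw [mem_edgeIdeal_iff hE] at h
  obtain ⟨⟨x, y⟩, hxy, h1, h2⟩ := h (Finsupp.single z 1 + f) (by
    rw [coeff_X_mul, hGf]
    exact one_ne_zero)
  have hx1 (hx : p x = 1) : False := by
    have hxz : x ≠ z := by
      rintro rfl
      omega
    simp [Finsupp.single_eq_of_ne hxz, hf₁ hx] at h1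
  rcases hxy with ⟨a, rfl, rfl⟩ | ⟨hx, hxy⟩
  · exact hx1 (hσ a)
  · dsimp only at hx hxy h2
    by_cases h : p x = 1
    · exact hx1 h
    · have hyz : y ≠ z := by
        rintro rfl
        omega
      have := hw y
      simp only [Finsupp.add_apply, Finsupp.single_eq_of_ne hyz, hf₂ y (by omega)] at h2
      omega

end LowerBound

theorem card_subtype_of_iff_or {α : Type*} [Finite α] (r p q : α → Prop)
    (h : ∀ x, r x ↔ p x ∨ q x) (hpq : ∀ x, p x → ¬q x) :
    Nat.card {x // r x} = Nat.card {x // p x} + Nat.card {x // q x} := by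
  classical
  rw [← Nat.card_sum]
  exact Nat.card_congr ((Equiv.subtypeEquivRight h).trans (subtypeOrEquiv p q
    (Pi.disjoint_iff.2 fun x => Prop.disjoint_iff.2 (not_and.2 (hpq x)))))

end

/-- **Theorem (second class, regularity).**
`D` is a vertex-weighted oriented `m`-partite graph (`m ≥ 2`) of the second
class: the vertex set is partitioned into nonempty parts `V_1, …, V_m`
(encoded by `part : V → Fin m`, with `|V_1| ≤ |V_2|`); `D_1` is a matching
pairing each vertex `a ∈ V_1` with a distinct vertex `σ a ∈ V_2`, its edges
directed from `V_2` to `V_1`; and for `2 ≤ i ≤ m-1` the edges between `V_i`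
and `V_{i+1}` form a complete bipartite graph directed from `V_i` to
`V_{i+1}`.  `D` has no isolated vertices, sources have weight `1`, and
non-source vertices outside `V_1 ⊔ V_m` have weight `≥ 2`.
Then `pd I(D) = |V \ V_1| - 2` if `|V_1| < |V_2|`, and
`pd I(D) = |V \ V_2| - 1` if `|V_1| = |V_2|`. -/
theorem second_class_pd (k : Type) [Field k] (m : ℕ) (hm : 2 ≤ m)
    (V : Type) [Fintype V] (part : V → Fin m) (hpart : ∀ i : Fin m, ∃ x : V, part x = i)
    (ht : Nat.card {x : V // (part x : ℕ) = 0} ≤ Nat.card {x : V // (part x : ℕ) = 1})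
    (σ : {x : V // (part x : ℕ) = 0} → V) (hσinj : Function.Injective σ)
    (hσ : ∀ a, (part (σ a) : ℕ) = 1)
    (E : Set (V × V))
    (hE : E = {p : V × V |
      (∃ a : {x : V // (part x : ℕ) = 0}, p.1 = σ a ∧ p.2 = (a : V)) ∨
      (1 ≤ (part p.1 : ℕ) ∧ (part p.2 : ℕ) = (part p.1 : ℕ) + 1)})
    (hiso : ∀ x : V, ∃ y : V, (x, y) ∈ E ∨ (y, x) ∈ E)
    (w : V → ℕ) (hw : ∀ x : V, 1 ≤ w x)
    (hsrc : ∀ x : V, (∀ y : V, (y, x) ∉ E) → w x = 1)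
    (hw2 : ∀ x : V, (∃ y : V, (y, x) ∈ E) →
      (part x : ℕ) ≠ 0 → (part x : ℕ) ≠ m - 1 → 2 ≤ w x)
    (R : WOG.MinFreeRes (WOG.edgeIdeal k E w)) :
    (Nat.card {x : V // (part x : ℕ) = 0} < Nat.card {x : V // (part x : ℕ) = 1} →
      IsGreatest R.pdSet (Nat.card {x : V // (part x : ℕ) ≠ 0} - 2)) ∧
    (Nat.card {x : V // (part x : ℕ) = 0} = Nat.card {x : V // (part x : ℕ) = 1} →
      IsGreatest R.pdSet (Nat.card {x : V // (part x : ℕ) ≠ 1} - 1)) := by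
  classical
  subst hE
  have hp : ∀ x, 2 ≤ (part x : ℕ) → ∃ u, (part x : ℕ) = part u + 1 := fun x hx => by
    obtain ⟨u, hu⟩ := hpart ⟨part x - 1, by omega⟩
    exact ⟨u, by rw [hu]; simp only; omega⟩
  have hlarge : ∀ u v, 2 ≤ (part u : ℕ) → (part v : ℕ) = part u + 1 → 2 ≤ w u := by
    intro u v hu hv
    obtain ⟨x, hx⟩ := hp u hu
    refine hw2 u ⟨x, Or.inr ⟨?_, hx⟩⟩ (by omega) ?_
    · change 1 ≤ (part x : ℕ)
      omega
    · have := (part v).isLt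
      omega
  have hcard₀ : Nat.card {x // (part x : ℕ) ≠ 0} =
      Nat.card {x // (part x : ℕ) = 1} + Nat.card {x // 2 ≤ (part x : ℕ)} :=
    card_subtype_of_iff_or _ _ _ (by omega) (by omega)
  have hcard₁ : Nat.card {x // (part x : ℕ) ≠ 1} =
      Nat.card {x // (part x : ℕ) = 0} + Nat.card {x // 2 ≤ (part x : ℕ)} :=
    card_subtype_of_iff_or _ _ _ (by omega) (by omega)
  obtain ⟨a₀, ha₀⟩ := hpart ⟨0, by omega⟩
  have hpos : 0 < Nat.card {x // (part x : ℕ) = 0} :=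
    have : Nonempty {x // (part x : ℕ) = 0} := ⟨⟨a₀, by rw [ha₀]⟩⟩
    Nat.card_pos
  have hgreatest : ∀ n, Nonempty (R.ι n) →
      MonomialPdLE k (edgeSet (secondClassEdges (fun x => (part x : ℕ)) σ) w) (n + 1) →
      IsGreatest R.pdSet n := fun n hn hle => by
    refine ⟨R.mem_pdSet_iff.2 hn, fun i hi => ?_⟩
    by_contra hni
    have := R.isEmpty_of_pdQuotLE
      (hle.edgeIdeal (fst_ne_snd_of_mem_secondClassEdges hσ)) (not_le.1 hni)
    exact not_isEmpty_iff.2 (R.mem_pdSet_iff.1 hi) this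
  have hτ : Function.Injective fun a => (⟨σ a, hσ a⟩ : {x // (part x : ℕ) = 1}) :=
    fun a b h => hσinj (congrArg Subtype.val h)
  refine ⟨fun hlt => ?_, fun heq => ?_⟩
  · obtain ⟨y₀, hy₀σ⟩ : ∃ y₀ : {x // (part x : ℕ) = 1}, ∀ a, σ a ≠ y₀ := by
      by_contra! h
      refine hlt.not_ge (Nat.card_le_card_of_surjective
        (fun a => (⟨σ a, hσ a⟩ : {x // (part x : ℕ) = 1})) fun y => ?_)
      obtain ⟨a, ha⟩ := h y
      exact ⟨a, Subtype.ext ha⟩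
    obtain ⟨z, hz⟩ : ∃ z, (part z : ℕ) = 2 := by
      have hy₀ := y₀.2
      obtain ⟨z, (⟨a, ha, -⟩ | ⟨-, h⟩) | (⟨a, -, ha⟩ | ⟨h, h'⟩)⟩ := hiso y₀
      · exact absurd ha.symm (hy₀σ a)
      · exact ⟨z, h.trans (by rw [hy₀])⟩
      · have := a.2
        simp only at ha
        rw [ha] at hy₀
        omega
      · simp only at h h'
        omega
    have hpos₂ : 0 < Nat.card {x // 2 ≤ (part x : ℕ)} :=
      have : Nonempty {x // 2 ≤ (part x : ℕ)} := ⟨⟨z, hz.ge⟩⟩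
      Nat.card_pos
    refine hgreatest _ (nonempty_of_not_surjective hσ hp hlarge hw y₀.2 hy₀σ hz R (by omega))
      (monomialPdLE_edgeSet hσinj hσ hw ?_ ?_ ?_) <;> omega
  · have hsurj := ((Nat.bijective_iff_injective_and_card _).2 ⟨hτ, heq⟩).2
    refine hgreatest _ (nonempty_of_surjective hσ hσinj (fun y hy => ?_) hp hlarge hw
      ⟨a₀, by rw [ha₀]⟩ R (by omega)) (monomialPdLE_edgeSet hσinj hσ hw ?_ ?_ ?_)
    · obtain ⟨a, ha⟩ := hsurj ⟨y, hy⟩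
      exact ⟨a, congrArg Subtype.val ha⟩
    all_goals omega
end
end
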